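/- Let n, m, l be positive integers with l < n, and let η be a C² map defined on an open neighborhood of the unit sphere S^n ⊂ ℝ^{n+1} with values in ℝ^{m+1} such that the rank of dη_x is at most l for every x ∈ S^n. Then there exists a constant C > 0 (one may take C = (√2/(n+1)) times the n-dimensional Hausdorff measure of the graph {(x, η(x)) : x ∈ S^n} ⊂ ℝ^{n+m+2}) such that for every R ≥ 1, every solution F of the Dirichlet problem for the minimal surface system on the open unit ball Ω = D^{n+1} with boundary data R·η|_{S^n} satisfies the mass bound M(F) = ∫_Ω √(g(x)) dx ≤ C·R^{l+1}. -/

import Mathlib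

open MeasureTheory

/-- The induced metric `g_{ij} = δ_{ij} + Σ_α ∂_i F^α ∂_j F^α` of the graph of `F`
(using the a.e.-defined total `fderiv`). -/
noncomputable def mssMetric {n m : ℕ}
    (F : EuclideanSpace ℝ (Fin (n+1)) → EuclideanSpace ℝ (Fin (m+1)))
    (x : EuclideanSpace ℝ (Fin (n+1))) : Matrix (Fin (n+1)) (Fin (n+1)) ℝ :=
  fun i j => (if i = j then (1:ℝ) else 0) +
    ∑ α : Fin (m+1),
      fderiv ℝ F x (EuclideanSpace.single i 1) α * fderiv ℝ F x (EuclideanSpace.single j 1) α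

/-- `F` is a solution of the Dirichlet problem for the minimal surface system on `Ω`
with boundary data `f`: continuous on `closure Ω`, Lipschitz on `Ω`, equal to `f` on `∂Ω`,
and weakly satisfying the minimal surface system. -/
def IsMSSolution (n m : ℕ) (Ω : Set (EuclideanSpace ℝ (Fin (n+1))))
    (f F : EuclideanSpace ℝ (Fin (n+1)) → EuclideanSpace ℝ (Fin (m+1))) : Prop :=
  ContinuousOn F (closure Ω) ∧
  (∃ K : NNReal, LipschitzOnWith K F Ω) ∧
  (∀ x ∈ frontier Ω, F x = f x) ∧
  (∀ φ : EuclideanSpace ℝ (Fin (n+1)) → ℝ, ContDiff ℝ (⊤ : ℕ∞) φ → HasCompactSupport φ →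
     tsupport φ ⊆ Ω →
     (∀ j : Fin (n+1),
        ∫ x in Ω, (∑ i : Fin (n+1),
          Real.sqrt (mssMetric F x).det * (mssMetric F x)⁻¹ i j *
            fderiv ℝ φ x (EuclideanSpace.single i 1)) = 0) ∧
     (∀ α : Fin (m+1),
        ∫ x in Ω, (∑ i : Fin (n+1), ∑ j : Fin (n+1),
          Real.sqrt (mssMetric F x).det * (mssMetric F x)⁻¹ i j *
            fderiv ℝ F x (EuclideanSpace.single j 1) α *
            fderiv ℝ φ x (EuclideanSpace.single i 1)) = 0))

section LinearAlgebra
open Matrix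
open scoped MatrixOrder

variable {ι κ : Type*} [Fintype ι] [Fintype κ]

lemma dotProduct_transpose_mul_mulVec (M : Matrix κ ι ℝ) (v w : ι → ℝ) :
    v ⬝ᵥ ((Mᵀ * M) *ᵥ w) = (M *ᵥ v) ⬝ᵥ (M *ᵥ w) := by
  rw [← mulVec_mulVec, dotProduct_mulVec, vecMul_transpose]

variable [DecidableEq ι]

lemma det_one_add_smul_eq_prod {Q : Matrix ι ι ℝ} (hQ : Q.IsHermitian) (c : ℝ) :
    (1 + c • Q).det = ∏ i, (1 + c * hQ.eigenvalues i) := by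
  have h1 := hQ.spectral_theorem
  rw [Unitary.conjStarAlgAut_apply] at h1
  set U := hQ.eigenvectorUnitary
  have hU : (U : Matrix ι ι ℝ) * star (U : Matrix ι ι ℝ) = 1 := Unitary.mul_star_self_of_mem U.2
  have h2 : (1 + c • Q) = (U : Matrix ι ι ℝ) *
      (1 + c • diagonal (RCLike.ofReal ∘ hQ.eigenvalues)) * star (U : Matrix ι ι ℝ) := by
    rw [Matrix.mul_add, Matrix.add_mul, Matrix.mul_one, hU, Matrix.mul_smul, Matrix.smul_mul, ← h1]
  rw [h2, det_mul_right_comm, hU, Matrix.one_mul, ← diagonal_one, ← diagonal_smul, diagonal_add,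
    det_diagonal]
  simp

lemma one_le_det_one_add {Q : Matrix ι ι ℝ} (hQ : Q.PosSemidef) : 1 ≤ (1 + Q).det := by
  have h := det_one_add_smul_eq_prod hQ.1 1
  rw [one_smul] at h
  rw [h]
  refine Finset.one_le_prod fun i _ => ?_
  have := hQ.eigenvalues_nonneg i
  linarith

lemma det_le_det_add {P S : Matrix ι ι ℝ} (hP : P.PosDef) (hS : S.PosSemidef) :
    P.det ≤ (P + S).det := by
  obtain ⟨B, rfl⟩ := CStarAlgebra.nonneg_iff_eq_star_mul_self.mp hS.nonneg
  rw [det_add_mul _ _ (isUnit_iff_ne_zero.mpr hP.det_pos.ne')]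
  exact le_mul_of_one_le_right hP.det_pos.le
    (one_le_det_one_add (hP.inv.posSemidef.mul_mul_conjTranspose_same B))

lemma det_add_vecMulVec_self {P : Matrix ι ι ℝ} (hP : P.PosDef) (x : ι → ℝ) :
    (P + vecMulVec x x).det = P.det * (1 + x ⬝ᵥ (P⁻¹ *ᵥ x)) := by
  rw [vecMulVec_eq Unit, det_add_replicateCol_mul_replicateRow
    (isUnit_iff_ne_zero.mpr hP.det_pos.ne'), det_unique (n := Unit)]
  congr 2
  rw [Matrix.mul_assoc]
  simp [Matrix.mul_apply, dotProduct, mulVec]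

lemma posDef_one_add_transpose_mul (M : Matrix κ ι ℝ) : (1 + Mᵀ * M).PosDef := by
  have h := posSemidef_conjTranspose_mul_self M
  rw [conjTranspose_eq_transpose_of_trivial] at h
  exact PosDef.one.add_posSemidef h

lemma dotProduct_one_add_transpose_mul_mulVec (M : Matrix κ ι ℝ) (v w : ι → ℝ) :
    v ⬝ᵥ ((1 + Mᵀ * M) *ᵥ w) = v ⬝ᵥ w + (M *ᵥ v) ⬝ᵥ (M *ᵥ w) := by
  rw [add_mulVec, one_mulVec, dotProduct_add, dotProduct_transpose_mul_mulVec]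

lemma one_add_transpose_mul_mulVec_inv (M : Matrix κ ι ℝ) (v : ι → ℝ) :
    (1 + Mᵀ * M) *ᵥ ((1 + Mᵀ * M)⁻¹ *ᵥ v) = v := by
  rw [mulVec_mulVec, mul_nonsing_inv _ ((isUnit_iff_isUnit_det _).mp
    (posDef_one_add_transpose_mul M).isUnit), one_mulVec]

/-- The determinant of `1 + 2 LᵀL` is controlled by the rank of `L`. -/
lemma det_one_add_two_smul_le {L : Matrix κ ι ℝ} {l : ℕ} {c : ℝ} (hL : L.rank ≤ l) (hc : 0 ≤ c)
    (hLc : ∀ v, (L *ᵥ v) ⬝ᵥ (L *ᵥ v) ≤ c * (v ⬝ᵥ v)) :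
    (1 + (2 : ℝ) • (Lᵀ * L)).det ≤ (1 + 2 * c) ^ l := by
  have hpsd := posSemidef_conjTranspose_mul_self L
  rw [conjTranspose_eq_transpose_of_trivial] at hpsd
  have hev : ∀ i, hpsd.1.eigenvalues i ≤ c := fun i => by
    set v : ι → ℝ := ⇑(hpsd.1.eigenvectorBasis i) with hv
    have h1 : (Lᵀ * L) *ᵥ v = hpsd.1.eigenvalues i • v := hpsd.1.mulVec_eigenvectorBasis i
    have h2 : v ⬝ᵥ v = 1 := by
      have h := hpsd.1.eigenvectorBasis.orthonormal.1 i
      have h' := EuclideanSpace.real_norm_sq_eq (hpsd.1.eigenvectorBasis i)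
      rw [h] at h'
      rw [dotProduct]
      simp only [hv]
      rw [one_pow] at h'
      rw [h']
      exact Finset.sum_congr rfl fun j _ => (sq _).symm
    have h3 := hLc v
    rw [← dotProduct_transpose_mul_mulVec, h1, dotProduct_smul, h2] at h3
    simpa using h3
  rw [det_one_add_smul_eq_prod hpsd.1 2]
  have hrank : Fintype.card {i // hpsd.1.eigenvalues i ≠ 0} ≤ l := by
    rw [← hpsd.1.rank_eq_card_non_zero_eigs, rank_transpose_mul_self]
    exact hL
  rw [Fintype.card_subtype] at hrank
  calc ∏ i, (1 + 2 * hpsd.1.eigenvalues i)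
      = ∏ i with hpsd.1.eigenvalues i ≠ 0, (1 + 2 * hpsd.1.eigenvalues i) := by
        refine (Finset.prod_subset (Finset.filter_subset _ _) fun i _ hi => ?_).symm
        have : hpsd.1.eigenvalues i = 0 := by simpa using hi
        rw [this]; norm_num
    _ ≤ ∏ i with hpsd.1.eigenvalues i ≠ 0, (1 + 2 * c) := by
        refine Finset.prod_le_prod (fun i _ => ?_) fun i _ => ?_
        · have := hpsd.eigenvalues_nonneg i
          linarith
        · have := hev i
          linarith
    _ ≤ (1 + 2 * c) ^ l := by
        rw [Finset.prod_const]
        exact pow_le_pow_right₀ (by linarith) hrank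

/-- For symmetric positive definite `P`, the quantity `det P * ⟨x, P⁻¹ x⟩` is the determinant of
the restriction of `P` to the orthogonal complement of `x`, up to the factor `|x| ^ 2`; here is
its monotonicity in terms of that restriction. -/
lemma det_mul_inv_le {P Q : Matrix ι ι ℝ} (hP : P.PosDef) (hQ : Q.PosDef) (x : ι → ℝ) {t : ℝ}
    (ht : 0 ≤ t) (h : ∀ v, v ⬝ᵥ (P *ᵥ v) ≤ v ⬝ᵥ (Q *ᵥ v) + t * (x ⬝ᵥ v) ^ 2) :
    P.det * (x ⬝ᵥ (P⁻¹ *ᵥ x)) ≤ Q.det * (x ⬝ᵥ (Q⁻¹ *ᵥ x)) := by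
  have hvec : ∀ s : ℝ, 0 ≤ s → s • vecMulVec x x = vecMulVec (√s • x) (√s • x) := fun s hs => by
    rw [smul_vecMulVec, vecMulVec_smul, smul_smul, Real.mul_self_sqrt hs]
  have hdet : ∀ {R : Matrix ι ι ℝ}, R.PosDef → ∀ s : ℝ, 0 ≤ s →
      (R + s • vecMulVec x x).det = R.det * (1 + s * (x ⬝ᵥ (R⁻¹ *ᵥ x))) := fun {R} hR s hs => by
    rw [hvec s hs, det_add_vecMulVec_self hR, mulVec_smul, dotProduct_smul, smul_dotProduct,
      smul_smul, Real.mul_self_sqrt hs, smul_eq_mul]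
  have hpd : ∀ {R : Matrix ι ι ℝ}, R.PosDef → ∀ s : ℝ, 0 ≤ s →
      (R + s • vecMulVec x x).PosDef := fun {R} hR s hs => by
    rw [hvec s hs]
    exact hR.add_posSemidef (by simpa using posSemidef_vecMulVec_self_star (√s • x))
  have key : ∀ s : ℝ, 0 ≤ s → P.det * (1 + s * (x ⬝ᵥ (P⁻¹ *ᵥ x))) ≤
      Q.det * (1 + (t + s) * (x ⬝ᵥ (Q⁻¹ *ᵥ x))) := fun s hs => by
    rw [← hdet hP s hs, ← hdet hQ (t + s) (add_nonneg ht hs)]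
    have hS : (Q + (t + s) • vecMulVec x x - (P + s • vecMulVec x x)).PosSemidef := by
      refine PosSemidef.of_dotProduct_mulVec_nonneg
        ((hpd hQ _ (add_nonneg ht hs)).1.sub (hpd hP s hs).1) fun v => ?_
      have := h v
      simp only [star_trivial, sub_mulVec, add_mulVec, dotProduct_sub, dotProduct_add,
        smul_mulVec, vecMulVec_mulVec, dotProduct_smul, smul_eq_mul, op_smul_eq_smul]
      rw [dotProduct_comm v x]
      nlinarith
    have := det_le_det_add (hpd hP s hs) hS
    rwa [add_sub_cancel] at this
  by_contra! hcon
  set a := P.det * (x ⬝ᵥ (P⁻¹ *ᵥ x))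
  set b := Q.det * (x ⬝ᵥ (Q⁻¹ *ᵥ x)) with hb
  have hab : 0 < a - b := by linarith
  have hk := key ((|Q.det - P.det + t * b| + 1) / (a - b)) (by positivity)
  have hs : (|Q.det - P.det + t * b| + 1) / (a - b) * (a - b) = |Q.det - P.det + t * b| + 1 :=
    div_mul_cancel₀ _ hab.ne'
  set s := (|Q.det - P.det + t * b| + 1) / (a - b)
  have h1 : P.det + s * a ≤ Q.det + (t + s) * b := by
    calc P.det + s * a = P.det * (1 + s * (x ⬝ᵥ (P⁻¹ *ᵥ x))) := by simp only [a]; ring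
      _ ≤ _ := hk
      _ = _ := by rw [hb]; ring
  have := le_abs_self (Q.det - P.det + t * b)
  nlinarith

/-- If `M = L + D + a xᵀ` with `L` of rank at most `l` then the area element of the
graph of `M` over the orthogonal complement of `x` is controlled. -/
lemma det_mul_inv_le_of_decomposition {M L D : Matrix κ ι ℝ} {a : κ → ℝ} {x : ι → ℝ} {l : ℕ}
    {c d : ℝ} (hM : M = L + D + vecMulVec a x) (hL : L.rank ≤ l) (hc : 0 ≤ c) (hd : 0 ≤ d)
    (hLc : ∀ v, (L *ᵥ v) ⬝ᵥ (L *ᵥ v) ≤ c * (v ⬝ᵥ v))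
    (hDd : ∀ v, (D *ᵥ v) ⬝ᵥ (D *ᵥ v) ≤ d * (v ⬝ᵥ v)) :
    (1 + Mᵀ * M).det * (x ⬝ᵥ ((1 + Mᵀ * M)⁻¹ *ᵥ x)) ≤
      (x ⬝ᵥ x) * ((1 + 4 * d) ^ Fintype.card ι * (1 + 2 * c) ^ l) := by
  have hQ0 : (1 + (2 : ℝ) • (Lᵀ * L)).PosDef := by
    have h := posSemidef_conjTranspose_mul_self L
    rw [conjTranspose_eq_transpose_of_trivial] at h
    exact PosDef.one.add_posSemidef (h.smul (by norm_num))
  have h4 : (0 : ℝ) < 1 + 4 * d := by linarith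
  set Q := (1 + 4 * d) • (1 + (2 : ℝ) • (Lᵀ * L)) with hQdef
  have hQ : Q.PosDef := hQ0.smul h4
  have hquad : ∀ v, v ⬝ᵥ (Q *ᵥ v) = (1 + 4 * d) * (v ⬝ᵥ v + 2 * ((L *ᵥ v) ⬝ᵥ (L *ᵥ v))) := by
    intro v
    rw [hQdef, smul_mulVec, add_mulVec, one_mulVec, smul_mulVec, dotProduct_smul, dotProduct_add,
      dotProduct_smul, dotProduct_transpose_mul_mulVec, smul_eq_mul, smul_eq_mul]
  have hsq : ∀ u : κ → ℝ, 0 ≤ u ⬝ᵥ u := fun u => Finset.sum_nonneg fun i _ => mul_self_nonneg _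
  have htwo : ∀ u w : κ → ℝ, (u + w) ⬝ᵥ (u + w) ≤ 2 * (u ⬝ᵥ u) + 2 * (w ⬝ᵥ w) := fun u w => by
    have := hsq (u - w)
    simp only [sub_dotProduct, dotProduct_sub, add_dotProduct, dotProduct_add] at this ⊢
    linarith
  have h1 : (1 + Mᵀ * M).det * (x ⬝ᵥ ((1 + Mᵀ * M)⁻¹ *ᵥ x)) ≤ Q.det * (x ⬝ᵥ (Q⁻¹ *ᵥ x)) := by
    refine det_mul_inv_le (posDef_one_add_transpose_mul M) hQ x (t := 4 * (a ⬝ᵥ a))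
      (by linarith [hsq a]) fun v => ?_
    rw [dotProduct_one_add_transpose_mul_mulVec, hquad, hM, add_assoc, add_mulVec, add_mulVec,
      vecMulVec_mulVec, op_smul_eq_smul]
    have e1 := htwo (L *ᵥ v) (D *ᵥ v + (x ⬝ᵥ v) • a)
    have e2 := htwo (D *ᵥ v) ((x ⬝ᵥ v) • a)
    rw [smul_dotProduct, dotProduct_smul, smul_eq_mul, smul_eq_mul] at e2
    have e3 := hDd v
    have e4 : 0 ≤ d * ((L *ᵥ v) ⬝ᵥ (L *ᵥ v)) := mul_nonneg hd (hsq _)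
    nlinarith
  have hQinv : x ⬝ᵥ (Q⁻¹ *ᵥ x) ≤ x ⬝ᵥ x := by
    set z := Q⁻¹ *ᵥ x with hz
    have hx : x = Q *ᵥ z := by
      rw [hz, mulVec_mulVec, mul_nonsing_inv _ ((isUnit_iff_isUnit_det _).mp hQ.isUnit),
        one_mulVec]
    have e1 : x ⬝ᵥ z = (1 + 4 * d) * (z ⬝ᵥ z + 2 * ((L *ᵥ z) ⬝ᵥ (L *ᵥ z))) := by
      rw [← hquad, ← hx, dotProduct_comm]
    have e2 : 0 ≤ (x - z) ⬝ᵥ (x - z) := Finset.sum_nonneg fun i _ => mul_self_nonneg _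
    have e3 : 0 ≤ z ⬝ᵥ z := Finset.sum_nonneg fun i _ => mul_self_nonneg _
    have e4 := hsq (L *ᵥ z)
    simp only [sub_dotProduct, dotProduct_sub, dotProduct_comm z x] at e2
    nlinarith [mul_nonneg hd e3, mul_nonneg hd e4]
  have hQdet : Q.det ≤ (1 + 4 * d) ^ Fintype.card ι * (1 + 2 * c) ^ l := by
    rw [hQdef, det_smul]
    exact mul_le_mul_of_nonneg_left (det_one_add_two_smul_le hL hc hLc) (by positivity)
  refine h1.trans ?_
  rw [mul_comm (x ⬝ᵥ x)]
  exact mul_le_mul hQdet hQinv (hQ.inv.posSemidef.dotProduct_mulVec_nonneg x) (by positivity)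

lemma dotProduct_self_le_inv {M : Matrix κ ι ℝ} {K : ℝ} (hK : 0 ≤ K)
    (hM : ∀ v, (M *ᵥ v) ⬝ᵥ (M *ᵥ v) ≤ K * (v ⬝ᵥ v)) (v : ι → ℝ) :
    v ⬝ᵥ v ≤ (1 + K) * (v ⬝ᵥ ((1 + Mᵀ * M)⁻¹ *ᵥ v)) := by
  set w := (1 + Mᵀ * M)⁻¹ *ᵥ v with hw
  have hv := one_add_transpose_mul_mulVec_inv M v
  rw [← hw] at hv
  have hPS : 0 ≤ (v - (1 + K) • w) ⬝ᵥ ((1 + Mᵀ * M) *ᵥ (v - (1 + K) • w)) := by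
    simpa using (posDef_one_add_transpose_mul M).posSemidef.dotProduct_mulVec_nonneg
      (v - (1 + K) • w)
  have hsymm : w ⬝ᵥ ((1 + Mᵀ * M) *ᵥ v) = v ⬝ᵥ v := by
    rw [dotProduct_one_add_transpose_mul_mulVec, dotProduct_comm w, dotProduct_comm (M *ᵥ w),
      ← dotProduct_one_add_transpose_mul_mulVec, hv]
  have hvv : v ⬝ᵥ ((1 + Mᵀ * M) *ᵥ v) ≤ (1 + K) * (v ⬝ᵥ v) := by
    rw [dotProduct_one_add_transpose_mul_mulVec]
    linarith [hM v]
  rw [mulVec_sub, mulVec_smul, hv] at hPS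
  simp only [sub_dotProduct, dotProduct_sub, smul_dotProduct, dotProduct_smul, hsymm,
    smul_eq_mul] at hPS
  rw [dotProduct_comm w v] at hPS
  have h1 : 0 ≤ (1 + K) * ((1 + K) * (v ⬝ᵥ w) - v ⬝ᵥ v) := by linarith
  have h2 := nonneg_of_mul_nonneg_right h1 (by linarith)
  linarith

lemma sq_dotProduct_inv_mulVec_le (M : Matrix κ ι ℝ) (x : ι → ℝ) (f : κ → ℝ) :
    (x ⬝ᵥ ((1 + Mᵀ * M)⁻¹ *ᵥ (x + Mᵀ *ᵥ f))) ^ 2 ≤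
      (x ⬝ᵥ ((1 + Mᵀ * M)⁻¹ *ᵥ x)) * (x ⬝ᵥ x + f ⬝ᵥ f) := by
  set z := (1 + Mᵀ * M)⁻¹ *ᵥ x with hz
  have hx : (1 + Mᵀ * M) *ᵥ z = x := one_add_transpose_mul_mulVec_inv M x
  have hsym : ((1 + Mᵀ * M)⁻¹)ᵀ = (1 + Mᵀ * M)⁻¹ := by
    have := (posDef_one_add_transpose_mul M).inv.1
    rwa [IsHermitian, conjTranspose_eq_transpose_of_trivial] at this
  have h1 : x ⬝ᵥ ((1 + Mᵀ * M)⁻¹ *ᵥ (x + Mᵀ *ᵥ f)) = z ⬝ᵥ x + (M *ᵥ z) ⬝ᵥ f := by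
    rw [dotProduct_mulVec, ← mulVec_transpose, hsym, ← hz, dotProduct_add, dotProduct_mulVec z,
      vecMul_transpose]
  have h2 : x ⬝ᵥ z = z ⬝ᵥ z + (M *ᵥ z) ⬝ᵥ (M *ᵥ z) := by
    rw [← dotProduct_one_add_transpose_mul_mulVec, hx, dotProduct_comm]
  rw [h1, h2]
  have := Finset.sum_mul_sq_le_sq_mul_sq Finset.univ (Sum.elim z (M *ᵥ z)) (Sum.elim x f)
  simpa [Fintype.sum_sum_type, dotProduct, sq] using this

end LinearAlgebra

section Analysis
open Matrix Metric Set Filter Topology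
open scoped NNReal ENNReal Convolution

variable {ι : Type*} [Fintype ι] [DecidableEq ι]

/-- The gradient of `φ`, as a vector of partial derivatives. -/
noncomputable def grad (φ : EuclideanSpace ℝ ι → ℝ) (x : EuclideanSpace ℝ ι) : ι → ℝ :=
  fun i => fderiv ℝ φ x (EuclideanSpace.single i 1)

lemma abs_grad_le (φ : EuclideanSpace ℝ ι → ℝ) (x : EuclideanSpace ℝ ι) (i : ι) :
    |grad φ x i| ≤ ‖fderiv ℝ φ x‖ := by
  have := (fderiv ℝ φ x).le_opNorm (EuclideanSpace.single i 1)
  simpa [grad] using this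

lemma measurable_grad (φ : EuclideanSpace ℝ ι → ℝ) (i : ι) : Measurable fun x => grad φ x i :=
  measurable_fderiv_apply_const ℝ φ _

omit [DecidableEq ι] in
/-- Mollifications of a Lipschitz function have uniformly bounded derivatives, which converge
almost everywhere. -/
lemma exists_smooth_approx {φ : EuclideanSpace ℝ ι → ℝ} {C : ℝ≥0} {r : ℝ}
    (hφ : LipschitzWith C φ) (hr : r < 1) (h0 : ∀ x, r ≤ ‖x‖ → φ x = 0) :
    ∃ ψ : ℕ → EuclideanSpace ℝ ι → ℝ, (∀ k, ContDiff ℝ (⊤ : ℕ∞) (ψ k)) ∧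
      (∀ k, HasCompactSupport (ψ k)) ∧ (∀ k, tsupport (ψ k) ⊆ ball 0 1) ∧
      (∀ k x, ‖fderiv ℝ (ψ k) x‖ ≤ C) ∧
      ∀ᵐ x, Tendsto (fun k => fderiv ℝ (ψ k) x) atTop (𝓝 (fderiv ℝ φ x)) := by
  have hd : ∀ k : ℕ, 0 < (1 - r) / (k + 2) := fun k => div_pos (by linarith) (by positivity)
  let ρ : ℕ → ContDiffBump (0 : EuclideanSpace ℝ ι) := fun k =>
    ⟨(1 - r) / (k + 2) / 2, (1 - r) / (k + 2), half_pos (hd k), half_lt_self (hd k)⟩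
  have hrad : ∀ k, (ρ k).rOut = (1 - r) / (k + 2) := fun k => rfl
  have hφint : LocallyIntegrable φ volume := hφ.continuous.locallyIntegrable
  have hdint : LocallyIntegrable (fderiv ℝ φ) volume := by
    refine (locallyIntegrable_const (C : ℝ)).mono
      (measurable_fderiv ℝ φ).aestronglyMeasurable ?_
    filter_upwards with x
    rw [Real.norm_of_nonneg C.coe_nonneg]
    exact norm_fderiv_le_of_lipschitz ℝ hφ
  set ψ : ℕ → EuclideanSpace ℝ ι → ℝ := fun k =>
    (ρ k).normed volume ⋆[ContinuousLinearMap.lsmul ℝ ℝ, volume] φ with hψ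
  have hsupp : ∀ k, Function.support (ψ k) ⊆ closedBall 0 (r + (1 - r) / (k + 2)) := by
    intro k
    refine (support_convolution_subset _).trans ?_
    rintro x hx
    obtain ⟨y, hy, z, hz, rfl⟩ := Set.mem_add.mp hx
    rw [(ρ k).support_normed_eq, mem_ball_zero_iff, hrad] at hy
    have hz' : ‖z‖ < r := by
      by_contra! hcon
      exact hz (h0 z hcon)
    rw [mem_closedBall_zero_iff]
    exact (norm_add_le _ _).trans (by linarith)
  have hfd : ∀ k x, HasFDerivAt (ψ k)
      (((ρ k).normed volume ⋆[ContinuousLinearMap.lsmul ℝ ℝ, volume] fderiv ℝ φ) x) x := by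
    intro k x
    have hρc : Continuous ((ρ k).normed volume) := (ρ k).continuous_normed
    have hρi : Integrable ((ρ k).normed volume) := (ρ k).integrable_normed
    have hcont : ∀ x', Continuous fun t => (ρ k).normed volume t • φ (x' - t) := fun x' =>
      hρc.smul (hφ.continuous.comp (continuous_const.sub continuous_id))
    refine (hasFDerivAt_integral_of_dominated_loc_of_lip (s := univ) (x₀ := x)
      (F := fun x t => (ρ k).normed volume t • φ (x - t))
      (F' := fun t => (ρ k).normed volume t • fderiv ℝ φ (x - t))
      (bound := fun t => (ρ k).normed volume t * C) univ_mem
      (Eventually.of_forall fun x' => (hcont x').aestronglyMeasurable) ?_ ?_ ?_ ?_ ?_).2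
    · exact (hcont x).integrable_of_hasCompactSupport
        ((ρ k).hasCompactSupport_normed.smul_right)
    · exact (hρc.measurable.smul ((measurable_fderiv ℝ φ).comp
        (measurable_const.sub measurable_id))).aestronglyMeasurable
    · filter_upwards with t
      refine LipschitzOnWith.of_dist_le_mul fun y _ z _ => ?_
      have hnn : 0 ≤ (ρ k).normed volume t := (ρ k).nonneg_normed t
      rw [Real.coe_nnabs, abs_of_nonneg (mul_nonneg hnn C.coe_nonneg), dist_eq_norm, ← smul_sub,
        norm_smul, Real.norm_of_nonneg hnn, mul_assoc, ← dist_eq_norm]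
      refine mul_le_mul_of_nonneg_left ?_ hnn
      simpa using hφ.dist_le_mul (y - t) (z - t)
    · exact hρi.mul_const _
    · have h1 := hφ.ae_differentiableAt (μ := volume)
      have h2 : ∀ᵐ t, DifferentiableAt ℝ φ (x - t) :=
        (Measure.measurePreserving_sub_left volume x).quasiMeasurePreserving.ae h1
      filter_upwards [h2] with t ht
      have h3 : HasFDerivAt (fun y => φ (y - t)) (fderiv ℝ φ (x - t)) x :=
        ht.hasFDerivAt.comp x ((hasFDerivAt_id x).sub_const t)
      exact HasFDerivAt.const_smul h3 ((ρ k).normed volume t)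
  refine ⟨ψ, fun k => ?_, fun k => ?_, fun k => ?_, fun k x => ?_, ?_⟩
  · exact (ρ k).hasCompactSupport_normed.contDiff_convolution_left _ (ρ k).contDiff_normed hφint
  · exact HasCompactSupport.of_support_subset_isCompact (isCompact_closedBall _ _) (hsupp k)
  · refine (closure_minimal (hsupp k) isClosed_closedBall).trans (closedBall_subset_ball ?_)
    have h1 : (1 - r) / (k + 2) ≤ (1 - r) / 2 :=
      div_le_div_of_nonneg_left (by linarith) two_pos (by linarith [k.cast_nonneg (α := ℝ)])
    linarith
  · rw [(hfd k x).fderiv]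
    have hρi : Integrable ((ρ k).normed (volume : Measure (EuclideanSpace ℝ ι))) :=
      (ρ k).integrable_normed
    refine (norm_integral_le_of_norm_le (hρi.mul_const (C : ℝ))
      (Eventually.of_forall fun t => ?_)).trans ?_
    · rw [ContinuousLinearMap.lsmul_apply, norm_smul, Real.norm_of_nonneg ((ρ k).nonneg_normed t)]
      exact mul_le_mul_of_nonneg_left (norm_fderiv_le_of_lipschitz ℝ hφ) ((ρ k).nonneg_normed t)
    · rw [integral_mul_const, (ρ k).integral_normed, one_mul]
  · have h1 : Tendsto (fun k => (ρ k).rOut) atTop (𝓝 0) := by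
      simp only [hrad]
      exact tendsto_const_nhds.div_atTop
        (tendsto_atTop_add_const_right _ _ tendsto_natCast_atTop_atTop)
    have h2 : ∀ᶠ k in atTop, (ρ k).rOut ≤ 2 * (ρ k).rIn :=
      Eventually.of_forall fun k => by
        change (1 - r) / (k + 2) ≤ 2 * ((1 - r) / (k + 2) / 2)
        linarith
    filter_upwards [ContDiffBump.ae_convolution_tendsto_right_of_locallyIntegrable h1 h2 hdint]
      with x hx
    simpa only [(hfd _ x).fderiv] using hx

lemma integral_eq_zero_of_lipschitzWith {b : EuclideanSpace ℝ ι → ι → ℝ} {Λ : ℝ}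
    (hbm : ∀ i, AEStronglyMeasurable (fun x => b x i) (volume.restrict (ball 0 1)))
    (hb : ∀ x ∈ ball 0 1, ∀ i, |b x i| ≤ Λ)
    (h : ∀ φ : EuclideanSpace ℝ ι → ℝ, ContDiff ℝ (⊤ : ℕ∞) φ → HasCompactSupport φ →
      tsupport φ ⊆ ball 0 1 → ∫ x in ball 0 1, grad φ x ⬝ᵥ b x = 0)
    {φ : EuclideanSpace ℝ ι → ℝ} {C : ℝ≥0} {r : ℝ}
    (hφ : LipschitzWith C φ) (hr : r < 1) (h0 : ∀ x, r ≤ ‖x‖ → φ x = 0) :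
    ∫ x in ball 0 1, grad φ x ⬝ᵥ b x = 0 := by
  obtain ⟨ψ, h1, h2, h3, h4, h5⟩ := exists_smooth_approx hφ hr h0
  have hlim : Tendsto (fun k => ∫ x in ball 0 1, grad (ψ k) x ⬝ᵥ b x) atTop
      (𝓝 (∫ x in ball 0 1, grad φ x ⬝ᵥ b x)) := by
    refine tendsto_integral_of_dominated_convergence (fun _ => ∑ _i : ι, C * Λ) (fun k => ?_)
      (integrableOn_const (measure_ball_lt_top).ne) (fun k => ?_) ?_
    · exact Finset.aestronglyMeasurable_fun_sum _ fun i _ =>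
        (measurable_grad (ψ k) i).aestronglyMeasurable.mul (hbm i)
    · filter_upwards [ae_restrict_mem measurableSet_ball] with x hx
      refine (Finset.abs_sum_le_sum_abs _ _).trans (Finset.sum_le_sum fun i _ => ?_)
      rw [abs_mul]
      exact mul_le_mul ((abs_grad_le _ _ _).trans (h4 k x)) (hb x hx i) (abs_nonneg _) C.coe_nonneg
    · filter_upwards [ae_restrict_of_ae h5] with x hx
      refine tendsto_finsetSum _ fun i _ => Tendsto.mul_const _ ?_
      exact ((ContinuousLinearMap.apply ℝ ℝ
        (EuclideanSpace.single i (1 : ℝ))).continuous.tendsto _).comp hx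
  simp only [h _ (h1 _) (h2 _) (h3 _)] at hlim
  exact tendsto_nhds_unique hlim tendsto_const_nhds

/-- Measurable and bounded on the unit ball. -/
def BddMeas (f : EuclideanSpace ℝ ι → ℝ) : Prop :=
  AEStronglyMeasurable f (volume.restrict (ball 0 1)) ∧ ∃ C, ∀ x ∈ ball 0 1, |f x| ≤ C

/-- Lipschitz on the unit ball. -/
def LipOnBall (f : EuclideanSpace ℝ ι → ℝ) : Prop :=
  ∃ K : ℝ≥0, LipschitzOnWith K f (ball 0 1)

/-- Lipschitz on the unit ball and vanishing at its boundary. -/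
def IsTest (φ : EuclideanSpace ℝ ι → ℝ) : Prop :=
  LipOnBall φ ∧ ∃ C, ∀ x ∈ ball 0 1, |φ x| ≤ C * (1 - ‖x‖)

namespace BddMeas

variable {f g : EuclideanSpace ℝ ι → ℝ}

omit [DecidableEq ι]

lemma const (c : ℝ) : BddMeas (fun _ : EuclideanSpace ℝ ι => c) :=
  ⟨aestronglyMeasurable_const, |c|, fun _ _ => le_rfl⟩

lemma add (hf : BddMeas f) (hg : BddMeas g) : BddMeas fun x => f x + g x := by
  obtain ⟨hf, C, hC⟩ := hf
  obtain ⟨hg, D, hD⟩ := hg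
  exact ⟨hf.add hg, C + D, fun x hx => (abs_add_le _ _).trans (add_le_add (hC x hx) (hD x hx))⟩

lemma mul (hf : BddMeas f) (hg : BddMeas g) : BddMeas fun x => f x * g x := by
  obtain ⟨hf, C, hC⟩ := hf
  obtain ⟨hg, D, hD⟩ := hg
  refine ⟨hf.mul hg, C * D, fun x hx => ?_⟩
  rw [abs_mul]
  exact mul_le_mul (hC x hx) (hD x hx) (abs_nonneg _) ((abs_nonneg _).trans (hC x hx))

lemma sum {α : Type*} (s : Finset α) {f : α → EuclideanSpace ℝ ι → ℝ}
    (hf : ∀ a ∈ s, BddMeas (f a)) : BddMeas fun x => ∑ a ∈ s, f a x := by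
  classical
  induction s using Finset.induction_on with
  | empty => simpa using const 0
  | insert a s ha ih =>
    simp only [Finset.sum_insert ha]
    exact (hf a (Finset.mem_insert_self a s)).add
      (ih fun b hb => hf b (Finset.mem_insert_of_mem hb))

lemma prod {α : Type*} (s : Finset α) {f : α → EuclideanSpace ℝ ι → ℝ}
    (hf : ∀ a ∈ s, BddMeas (f a)) : BddMeas fun x => ∏ a ∈ s, f a x := by
  classical
  induction s using Finset.induction_on with
  | empty => simpa using const 1
  | insert a s ha ih =>
    simp only [Finset.prod_insert ha]
    exact (hf a (Finset.mem_insert_self a s)).mul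
      (ih fun b hb => hf b (Finset.mem_insert_of_mem hb))

lemma integrableOn (hf : BddMeas f) : IntegrableOn f (ball 0 1) := by
  obtain ⟨hf, C, hC⟩ := hf
  refine Integrable.mono' (integrableOn_const (C := C) measure_ball_lt_top.ne) hf ?_
  filter_upwards [ae_restrict_mem measurableSet_ball] with x hx using hC x hx

lemma dotProduct {v w : EuclideanSpace ℝ ι → ι → ℝ} (hv : ∀ i, BddMeas fun x => v x i)
    (hw : ∀ i, BddMeas fun x => w x i) : BddMeas fun x => v x ⬝ᵥ w x :=
  sum _ fun i _ => (hv i).mul (hw i)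

lemma mulVec {A : EuclideanSpace ℝ ι → Matrix ι ι ℝ} {w : EuclideanSpace ℝ ι → ι → ℝ}
    (hA : ∀ i j, BddMeas fun x => A x i j) (hw : ∀ i, BddMeas fun x => w x i) (i : ι) :
    BddMeas fun x => (A x *ᵥ w x) i :=
  sum _ fun j _ => (hA i j).mul (hw j)

end BddMeas

namespace LipOnBall

variable {f g : EuclideanSpace ℝ ι → ℝ}

section
omit [DecidableEq ι]

lemma bddMeas (hf : LipOnBall f) : BddMeas f := by
  obtain ⟨K, hK⟩ := hf
  refine ⟨hK.continuousOn.aestronglyMeasurable measurableSet_ball, |f 0| + K, fun x hx => ?_⟩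
  have h1 := hK.dist_le_mul x hx 0 (mem_ball_self one_pos)
  rw [dist_zero_right, Real.dist_eq] at h1
  have h2 : ‖x‖ ≤ 1 := (mem_ball_zero_iff.mp hx).le
  have h3 := abs_sub_abs_le_abs_sub (f x) (f 0)
  nlinarith [K.coe_nonneg]

lemma const (c : ℝ) : LipOnBall (fun _ : EuclideanSpace ℝ ι => c) :=
  ⟨0, (LipschitzWith.const c).lipschitzOnWith⟩

lemma add (hf : LipOnBall f) (hg : LipOnBall g) : LipOnBall fun x => f x + g x := by
  obtain ⟨K, hK⟩ := hf
  obtain ⟨L, hL⟩ := hg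
  exact ⟨K + L, hK.add hL⟩

lemma mul (hf : LipOnBall f) (hg : LipOnBall g) : LipOnBall fun x => f x * g x := by
  obtain ⟨-, C, hC⟩ := hf.bddMeas
  obtain ⟨-, D, hD⟩ := hg.bddMeas
  obtain ⟨K, hK⟩ := hf
  obtain ⟨L, hL⟩ := hg
  have hC0 : 0 ≤ C := (abs_nonneg _).trans (hC 0 (mem_ball_self one_pos))
  have hD0 : 0 ≤ D := (abs_nonneg _).trans (hD 0 (mem_ball_self one_pos))
  refine ⟨(K * D + C * L).toNNReal, LipschitzOnWith.of_dist_le_mul fun x hx y hy => ?_⟩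
  rw [Real.coe_toNNReal _ (by positivity)]
  have h1 := hK.dist_le_mul x hx y hy
  have h2 := hL.dist_le_mul x hx y hy
  rw [Real.dist_eq] at h1 h2 ⊢
  calc |f x * g x - f y * g y| = |(f x - f y) * g x + f y * (g x - g y)| := by ring_nf
    _ ≤ |f x - f y| * |g x| + |f y| * |g x - g y| := by
        rw [← abs_mul, ← abs_mul]; exact abs_add_le _ _
    _ ≤ (K * dist x y) * D + C * (L * dist x y) := by
        refine add_le_add (mul_le_mul h1 (hD x hx) (abs_nonneg _) (by positivity))
          (mul_le_mul (hC y hy) h2 (abs_nonneg _) hC0)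
    _ = _ := by ring

lemma neg (hf : LipOnBall f) : LipOnBall fun x => -f x := by
  simpa using (const (-1)).mul hf

lemma sub (hf : LipOnBall f) (hg : LipOnBall g) : LipOnBall fun x => f x - g x := by
  simpa [sub_eq_add_neg] using hf.add hg.neg

lemma inv (hf : LipOnBall f) {c : ℝ} (hc : 0 < c) (hfc : ∀ x ∈ ball 0 1, c ≤ f x) :
    LipOnBall fun x => (f x)⁻¹ := by
  obtain ⟨K, hK⟩ := hf
  refine ⟨(K / c ^ 2 : ℝ).toNNReal, LipschitzOnWith.of_dist_le_mul fun x hx y hy => ?_⟩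
  rw [Real.coe_toNNReal _ (by positivity)]
  have h1 := hK.dist_le_mul y hy x hx
  have hx' := hfc x hx
  have hy' := hfc y hy
  rw [Real.dist_eq] at h1 ⊢
  rw [inv_sub_inv (hc.trans_le hx').ne' (hc.trans_le hy').ne', abs_div,
    abs_of_pos (mul_pos (hc.trans_le hx') (hc.trans_le hy')), dist_comm x y,
    div_mul_eq_mul_div]
  refine div_le_div₀ (by positivity) h1 (by positivity) ?_
  rw [sq]
  exact mul_le_mul hx' hy' hc.le (hc.le.trans hx')

lemma of_contDiff (hf : ContDiff ℝ 1 f) : LipOnBall f := by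
  obtain ⟨K, hK⟩ := hf.contDiffOn.exists_lipschitzOnWith one_ne_zero
    (convex_closedBall (0 : EuclideanSpace ℝ ι) 1) (isCompact_closedBall 0 1)
  exact ⟨K, hK.mono ball_subset_closedBall⟩

lemma ae_differentiableAt (hf : LipOnBall f) :
    ∀ᵐ x ∂(volume.restrict (ball 0 1)), DifferentiableAt ℝ f x := by
  obtain ⟨K, hK⟩ := hf
  filter_upwards [ae_restrict_of_ae hK.ae_differentiableWithinAt_of_mem,
    ae_restrict_mem measurableSet_ball] with x hx hxb
  exact (hx hxb).differentiableAt (isOpen_ball.mem_nhds hxb)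

end

lemma grad_bddMeas (hf : LipOnBall f) (i : ι) : BddMeas fun x => grad f x i := by
  obtain ⟨K, hK⟩ := hf
  refine ⟨(measurable_grad f i).aestronglyMeasurable, K, fun x hx => ?_⟩
  exact (abs_grad_le f x i).trans (norm_fderiv_le_of_lipschitzOn ℝ (isOpen_ball.mem_nhds hx) hK)

end LipOnBall

omit [DecidableEq ι] in
lemma IsTest.mul_left {φ g : EuclideanSpace ℝ ι → ℝ} (hφ : IsTest φ) (hg : LipOnBall g) :
    IsTest fun x => g x * φ x := by
  obtain ⟨hL, C, hC⟩ := hφ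
  obtain ⟨-, D, hD⟩ := hg.bddMeas
  refine ⟨hg.mul hL, D * C, fun x hx => ?_⟩
  rw [abs_mul, mul_assoc]
  exact mul_le_mul (hD x hx) (hC x hx) (abs_nonneg _) ((abs_nonneg _).trans (hD x hx))

lemma integral_eq_zero_of_isTest {b : EuclideanSpace ℝ ι → ι → ℝ}
    (hb : ∀ i, BddMeas fun x => b x i)
    (h : ∀ φ : EuclideanSpace ℝ ι → ℝ, ContDiff ℝ (⊤ : ℕ∞) φ → HasCompactSupport φ →
      tsupport φ ⊆ ball 0 1 → ∫ x in ball 0 1, grad φ x ⬝ᵥ b x = 0)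
    {φ : EuclideanSpace ℝ ι → ℝ} (hφ : IsTest φ) :
    ∫ x in ball 0 1, grad φ x ⬝ᵥ b x = 0 := by
  choose hbm Λi hΛi using hb
  obtain ⟨Λ, hΛ⟩ : ∃ Λ, ∀ x ∈ ball 0 1, ∀ i, |b x i| ≤ Λ :=
    ⟨∑ i, |Λi i|, fun x hx i => (hΛi i x hx).trans <| (le_abs_self _).trans <|
      Finset.single_le_sum (f := fun i => |Λi i|) (fun _ _ => abs_nonneg _) (Finset.mem_univ i)⟩
  obtain ⟨⟨K, hK⟩, C', hC'⟩ := hφ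
  obtain ⟨C, hC⟩ : ∃ C : ℝ≥0, 0 < C ∧ ∀ x ∈ ball 0 1, |φ x| ≤ C * (1 - ‖x‖) := by
    refine ⟨(|C'| + 1).toNNReal, Real.toNNReal_pos.mpr (by positivity),
      fun x hx => (hC' x hx).trans ?_⟩
    rw [Real.coe_toNNReal _ (by positivity)]
    have h1 : 0 ≤ 1 - ‖x‖ := by linarith [mem_ball_zero_iff.mp hx]
    exact mul_le_mul_of_nonneg_right (by linarith [le_abs_self C']) h1
  obtain ⟨hC0, hC⟩ := hC
  obtain ⟨Φ, hΦ, hΦeq⟩ := hK.extend_real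
  let β : ℕ → EuclideanSpace ℝ ι → ℝ := fun k x => 2 * C * max 0 (1 - 1 / (k + 2) - ‖x‖)
  have hβ : ∀ k, LipschitzWith (2 * C) (β k) := fun k => by
    refine LipschitzWith.of_dist_le_mul fun x y => ?_
    rw [Real.dist_eq]
    simp only [β]
    rw [← mul_sub, abs_mul, abs_of_nonneg (by positivity : (0 : ℝ) ≤ 2 * C)]
    push_cast
    refine mul_le_mul_of_nonneg_left ?_ (by positivity)
    refine (abs_max_sub_max_le_max _ _ _ _).trans (max_le (by simp) ?_)
    rw [sub_sub_sub_cancel_left, abs_sub_comm, dist_eq_norm]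
    exact abs_norm_sub_norm_le x y
  have hβneg : ∀ k, LipschitzWith (2 * C) (fun x => -β k x) := fun k => (hβ k).neg
  let ψ : ℕ → EuclideanSpace ℝ ι → ℝ := fun k x => max (-β k x) (min (Φ x) (β k x))
  have hψ : ∀ k, LipschitzWith (max (2 * C) (max K (2 * C))) (ψ k) := fun k =>
    (hβneg k).max (hΦ.min (hβ k))
  have hψ0 : ∀ (k : ℕ) x, 1 - 1 / ((k : ℝ) + 2) ≤ ‖x‖ → ψ k x = 0 := fun k x hx => by
    have h1 : β k x = 0 := by
      simp only [β]
      rw [max_eq_left (by linarith), mul_zero]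
    simp only [ψ, h1, neg_zero]
    exact max_eq_left (min_le_right _ _)
  have hzero : ∀ k, ∫ x in ball 0 1, grad (ψ k) x ⬝ᵥ b x = 0 := fun k =>
    integral_eq_zero_of_lipschitzWith hbm hΛ h (hψ k)
      (sub_lt_self _ (by positivity : (0 : ℝ) < 1 / ((k : ℝ) + 2))) (hψ0 k)
  have hlim : Tendsto (fun k => ∫ x in ball 0 1, grad (ψ k) x ⬝ᵥ b x) atTop
      (𝓝 (∫ x in ball 0 1, grad φ x ⬝ᵥ b x)) := by
    refine tendsto_integral_of_dominated_convergence
      (fun _ => ∑ _i : ι, ((max (2 * C) (max K (2 * C)) : ℝ≥0) : ℝ) * Λ) (fun k => ?_)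
      (integrableOn_const (measure_ball_lt_top).ne) (fun k => ?_) ?_
    · exact Finset.aestronglyMeasurable_fun_sum _ fun i _ =>
        (measurable_grad (ψ k) i).aestronglyMeasurable.mul (hbm i)
    · filter_upwards [ae_restrict_mem measurableSet_ball] with x hx
      refine (Finset.abs_sum_le_sum_abs _ _).trans (Finset.sum_le_sum fun i _ => ?_)
      rw [abs_mul]
      exact mul_le_mul ((abs_grad_le _ _ _).trans (norm_fderiv_le_of_lipschitz ℝ (hψ k)))
        (hΛ x hx i) (abs_nonneg _) (NNReal.coe_nonneg _)
    · filter_upwards [ae_restrict_mem measurableSet_ball] with x hx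
      have hx1 := mem_ball_zero_iff.mp hx
      have hk : ∀ᶠ k : ℕ in atTop, 1 / ((k : ℝ) + 2) < (1 - ‖x‖) / 4 := by
        have : Tendsto (fun k : ℕ => 1 / ((k : ℝ) + 2)) atTop (𝓝 0) :=
          tendsto_const_nhds.div_atTop
            (tendsto_atTop_add_const_right _ _ tendsto_natCast_atTop_atTop)
        exact this.eventually_lt_const (by linarith)
      refine tendsto_const_nhds.congr' ?_
      filter_upwards [hk] with k hk
      have hev : ψ k =ᶠ[𝓝 x] φ := by
        have hy : ∀ᶠ y in 𝓝 x, ‖y‖ < (1 + ‖x‖) / 2 :=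
          continuous_norm.continuousAt.eventually_lt_const (by linarith)
        filter_upwards [hy, isOpen_ball.mem_nhds hx] with y hy hyb
        have h1 := abs_le.mp (hC y hyb)
        have h2 : 1 - ‖y‖ ≤ 2 * max 0 (1 - 1 / ((k : ℝ) + 2) - ‖y‖) := by
          linarith [le_max_right 0 (1 - 1 / ((k : ℝ) + 2) - ‖y‖)]
        have h3 : (C : ℝ) * (1 - ‖y‖) ≤ β k y := by
          simp only [β]
          calc (C : ℝ) * (1 - ‖y‖) ≤ C * (2 * max 0 (1 - 1 / ((k : ℝ) + 2) - ‖y‖)) :=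
                mul_le_mul_of_nonneg_left h2 C.coe_nonneg
            _ = _ := by ring
        simp only [ψ]
        rw [← hΦeq hyb, min_eq_left (by linarith), max_eq_right (by linarith)]
      have hg : grad (ψ k) x = grad φ x := by
        unfold grad
        rw [hev.fderiv_eq]
      rw [hg]
  simp only [hzero] at hlim
  exact tendsto_nhds_unique hlim tendsto_const_nhds

namespace BddMeas

variable {f : EuclideanSpace ℝ ι → ℝ}

omit [DecidableEq ι] in
lemma sqrt (hf : BddMeas f) : BddMeas fun x => √(f x) := by
  obtain ⟨hf, C, hC⟩ := hf
  refine ⟨(Real.continuous_sqrt.measurable.comp_aemeasurable hf.aemeasurable).aestronglyMeasurable,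
    √C, fun x hx => ?_⟩
  rw [abs_of_nonneg (Real.sqrt_nonneg _)]
  exact Real.sqrt_le_sqrt ((le_abs_self _).trans (hC x hx))

omit [DecidableEq ι] in
lemma inv (hf : BddMeas f) (h1 : ∀ x, 1 ≤ f x) : BddMeas fun x => (f x)⁻¹ := by
  refine ⟨hf.1.aemeasurable.inv.aestronglyMeasurable, 1, fun x _ => ?_⟩
  rw [abs_of_nonneg (inv_nonneg.mpr (zero_le_one.trans (h1 x)))]
  exact inv_le_one_of_one_le₀ (h1 x)

lemma det {A : EuclideanSpace ℝ ι → Matrix ι ι ℝ} (hA : ∀ i j, BddMeas fun x => A x i j) :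
    BddMeas fun x => (A x).det := by
  simp only [Matrix.det_apply']
  exact sum _ fun σ _ => (const _).mul (prod _ fun i _ => hA _ _)

lemma adjugate {A : EuclideanSpace ℝ ι → Matrix ι ι ℝ} (hA : ∀ i j, BddMeas fun x => A x i j)
    (i j : ι) : BddMeas fun x => (A x).adjugate i j := by
  simp only [Matrix.adjugate_apply]
  refine det fun k l => ?_
  simp only [Matrix.updateRow_apply]
  split_ifs
  exacts [const _, hA k l]

end BddMeas

section Gradient

variable {f g : EuclideanSpace ℝ ι → ℝ} {x : EuclideanSpace ℝ ι}

lemma grad_mul (hf : DifferentiableAt ℝ f x) (hg : DifferentiableAt ℝ g x) :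
    grad (fun y => f y * g y) x = f x • grad g x + g x • grad f x := by
  ext i
  simp [grad, fderiv_fun_mul hf hg]

lemma grad_sub (hf : DifferentiableAt ℝ f x) (hg : DifferentiableAt ℝ g x) :
    grad (fun y => f y - g y) x = grad f x - grad g x := by
  ext i
  simp [grad, fderiv_fun_sub hf hg]

lemma grad_const_mul (c : ℝ) (hf : DifferentiableAt ℝ f x) :
    grad (fun y => c * f y) x = c • grad f x := by
  ext i
  simp [grad, fderiv_const_mul hf]

lemma grad_inv (hf : DifferentiableAt ℝ f x) (h0 : f x ≠ 0) :
    grad (fun y => (f y)⁻¹) x = -((f x)⁻¹ ^ 2 • grad f x) := by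
  ext i
  have := (hasDerivAt_inv h0).comp_hasFDerivAt x hf.hasFDerivAt
  have h2 : fderiv ℝ (fun y => (f y)⁻¹) x = _ := this.fderiv
  simp [grad, h2]

lemma grad_coord (i : ι) (x : EuclideanSpace ℝ ι) :
    grad (fun y : EuclideanSpace ℝ ι => y i) x = Pi.single i 1 := by
  ext j
  have h : fderiv ℝ (fun y : EuclideanSpace ℝ ι => y i) x = EuclideanSpace.proj i :=
    (EuclideanSpace.proj (𝕜 := ℝ) i).hasFDerivAt.fderiv
  simp [grad, h, Pi.single_apply, eq_comm]

end Gradient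

/-- The function `(1 - ‖x‖²) / 2`, comparable to the distance to the unit sphere. -/
noncomputable def radialGap (x : EuclideanSpace ℝ ι) : ℝ := (1 - ‖x‖ ^ 2) / 2

omit [DecidableEq ι] in
lemma contDiff_radialGap : ContDiff ℝ 2 (radialGap : EuclideanSpace ℝ ι → ℝ) :=
  (contDiff_const.sub (contDiff_norm_sq ℝ)).div_const 2

lemma grad_radialGap (x : EuclideanSpace ℝ ι) : grad radialGap x = -x.ofLp := by
  ext i
  have h := ((hasStrictFDerivAt_norm_sq x).hasFDerivAt.const_sub 1).const_mul (2 : ℝ)⁻¹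
  have h2 : (radialGap : EuclideanSpace ℝ ι → ℝ) = fun y => (2 : ℝ)⁻¹ * (1 - ‖y‖ ^ 2) := by
    ext y; rw [radialGap]; ring
  rw [grad, h2, h.fderiv]
  simp [EuclideanSpace.inner_single_right]

omit [DecidableEq ι] in
lemma radialGap_le {x : EuclideanSpace ℝ ι} (hx : x ∈ ball 0 1) : radialGap x ≤ 1 - ‖x‖ := by
  rw [mem_ball_zero_iff] at hx
  rw [radialGap]
  nlinarith [norm_nonneg x]

omit [DecidableEq ι] in
lemma one_sub_norm_le {x : EuclideanSpace ℝ ι} (hx : x ∈ ball 0 1) :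
    1 - ‖x‖ ≤ 2 * radialGap x := by
  rw [mem_ball_zero_iff] at hx
  rw [radialGap]
  nlinarith [norm_nonneg x]

omit [DecidableEq ι] in
lemma radialGap_pos {x : EuclideanSpace ℝ ι} (hx : x ∈ ball 0 1) : 0 < radialGap x := by
  have := one_sub_norm_le hx
  rw [mem_ball_zero_iff] at hx
  linarith

omit [DecidableEq ι] in
lemma isTest_radialGap : IsTest (radialGap : EuclideanSpace ℝ ι → ℝ) :=
  ⟨.of_contDiff (contDiff_radialGap.of_le one_le_two), 1, fun x hx => by
    rw [abs_of_pos (radialGap_pos hx), one_mul]; exact radialGap_le hx⟩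

omit [DecidableEq ι] in
lemma LipOnBall.inv_radialGap_add {s : ℝ} (hs : 0 < s) :
    LipOnBall fun x : EuclideanSpace ℝ ι => (radialGap x + s)⁻¹ :=
  (isTest_radialGap.1.add (.const s)).inv hs fun x hx => by linarith [radialGap_pos hx]

omit [DecidableEq ι] in
lemma differentiableAt_radialGap (x : EuclideanSpace ℝ ι) : DifferentiableAt ℝ radialGap x :=
  contDiff_radialGap.contDiffAt.differentiableAt two_ne_zero

lemma grad_inv_radialGap_add {s : ℝ} (hs : 0 < s) {x : EuclideanSpace ℝ ι} (hx : x ∈ ball 0 1) :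
    grad (fun y => (radialGap y + s)⁻¹) x = (radialGap x + s)⁻¹ ^ 2 • x.ofLp := by
  have h : grad (fun y => radialGap y + s) x = -x.ofLp := by
    rw [← grad_radialGap]
    unfold grad
    simp
  rw [grad_inv ((differentiableAt_radialGap x).add_const s)
    (by linarith [radialGap_pos hx]), h, smul_neg, neg_neg]

section Energy

variable {A : EuclideanSpace ℝ ι → Matrix ι ι ℝ}

omit [DecidableEq ι] in
lemma LipOnBall.coord (i : ι) : LipOnBall fun x : EuclideanSpace ℝ ι => x i :=
  .of_contDiff (by fun_prop)

lemma LipOnBall.grad_of_contDiff {w : EuclideanSpace ℝ ι → ℝ} (hw : ContDiff ℝ 2 w) (j : ι) :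
    LipOnBall fun x => grad w x j :=
  .of_contDiff ((hw.fderiv_right (m := 1) (by norm_num)).clm_apply contDiff_const)

/-- Integration by parts for a coefficient field with divergence-free columns. -/
lemma integral_divergence_eq_zero (hA : ∀ i j, BddMeas fun x => A x i j)
    (hdiv : ∀ (j : ι) (φ : EuclideanSpace ℝ ι → ℝ), IsTest φ →
      ∫ x in ball 0 1, grad φ x ⬝ᵥ (fun i => A x i j) = 0)
    {p : EuclideanSpace ℝ ι → ι → ℝ} (hp : ∀ j, LipOnBall fun x => p x j)
    {φ : EuclideanSpace ℝ ι → ℝ} (hφ : IsTest φ) :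
    ∫ x in ball 0 1, (grad φ x ⬝ᵥ (A x *ᵥ p x) +
      φ x * ∑ j, grad (fun y => p y j) x ⬝ᵥ (fun i => A x i j)) = 0 := by
  have hae : ∀ᵐ x ∂(volume.restrict (ball 0 1)),
      ∑ j, grad (fun y => p y j * φ y) x ⬝ᵥ (fun i => A x i j) =
        grad φ x ⬝ᵥ (A x *ᵥ p x) +
          φ x * ∑ j, grad (fun y => p y j) x ⬝ᵥ (fun i => A x i j) := by
    have hp' : ∀ᵐ x ∂(volume.restrict (ball 0 1)), ∀ j,
        DifferentiableAt ℝ (fun y => p y j) x :=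
      ae_all_iff.mpr fun j => (hp j).ae_differentiableAt
    filter_upwards [hφ.1.ae_differentiableAt, hp'] with x h1 h2
    have hsum : ∑ j, p x j * (grad φ x ⬝ᵥ fun i => A x i j) = grad φ x ⬝ᵥ (A x *ᵥ p x) := by
      simp only [dotProduct, mulVec, Finset.mul_sum]
      rw [Finset.sum_comm]
      exact Finset.sum_congr rfl fun i _ => Finset.sum_congr rfl fun j _ => by ring
    rw [← hsum, Finset.mul_sum, ← Finset.sum_add_distrib]
    refine Finset.sum_congr rfl fun j _ => ?_
    rw [grad_mul (h2 j) h1, add_dotProduct, smul_dotProduct, smul_dotProduct, smul_eq_mul,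
      smul_eq_mul]
  rw [← integral_congr_ae hae, integral_finsetSum]
  · exact Finset.sum_eq_zero fun j _ => hdiv j _ (hφ.mul_left (hp j))
  · exact fun j _ => (BddMeas.dotProduct
      (fun i => (hφ.mul_left (hp j)).1.grad_bddMeas i) fun i => hA i j).integrableOn

/-- A coefficient field with divergence-free columns maps gradients of `C²` functions to fields
of bounded divergence. -/
lemma exists_abs_integral_le_of_contDiff (hA : ∀ i j, BddMeas fun x => A x i j)
    (hdiv : ∀ (j : ι) (φ : EuclideanSpace ℝ ι → ℝ), IsTest φ →
      ∫ x in ball 0 1, grad φ x ⬝ᵥ (fun i => A x i j) = 0)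
    {w : EuclideanSpace ℝ ι → ℝ} (hw : ContDiff ℝ 2 w) :
    ∃ C : ℝ, ∀ (φ : EuclideanSpace ℝ ι → ℝ) (S : ℝ), IsTest φ →
      (∀ x ∈ ball 0 1, |φ x| ≤ S) →
      |∫ x in ball 0 1, grad φ x ⬝ᵥ (A x *ᵥ grad w x)| ≤ C * S := by
  have hw1 := LipOnBall.grad_of_contDiff hw
  set q : EuclideanSpace ℝ ι → ℝ := fun x =>
    ∑ j, grad (fun y => grad w y j) x ⬝ᵥ (fun i => A x i j) with hq
  have hqb : BddMeas q := .sum _ fun j _ => .dotProduct (fun i => (hw1 j).grad_bddMeas i)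
    fun i => hA i j
  obtain ⟨D, hD⟩ := hqb.2
  refine ⟨D * volume.real (ball (0 : EuclideanSpace ℝ ι) 1), fun φ S hφ hS => ?_⟩
  have hzero : ∫ x in ball 0 1, (grad φ x ⬝ᵥ (A x *ᵥ grad w x) + φ x * q x) = 0 :=
    integral_divergence_eq_zero hA hdiv hw1 hφ
  have hint : IntegrableOn (fun x => grad φ x ⬝ᵥ (A x *ᵥ grad w x)) (ball 0 1) :=
    (BddMeas.dotProduct hφ.1.grad_bddMeas
      (BddMeas.mulVec hA fun j => (hw1 j).bddMeas)).integrableOn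
  rw [integral_add hint (hφ.1.bddMeas.mul hqb).integrableOn] at hzero
  rw [eq_neg_of_add_eq_zero_left hzero, abs_neg]
  have h := norm_setIntegral_le_of_norm_le_const (f := fun x => φ x * q x) (C := S * D)
    (measure_ball_lt_top (μ := volume) (x := (0 : EuclideanSpace ℝ ι)) (r := 1)) fun x hx => by
      rw [norm_mul]
      exact mul_le_mul (hS x hx) (hD x hx) (abs_nonneg _) ((abs_nonneg _).trans (hS x hx))
  calc _ ≤ _ := h
    _ = _ := by ring

/-- Fatou's lemma for bounded sequences of integrals of nonnegative functions. -/
lemma integrable_of_tendsto_of_integral_le {α : Type*} [MeasurableSpace α] {μ : Measure α}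
    {f : ℕ → α → ℝ} {g : α → ℝ} {C : ℝ} (hf : ∀ k, Integrable (f k) μ)
    (h0 : ∀ k, 0 ≤ᵐ[μ] f k) (hC : ∀ k, ∫ x, f k x ∂μ ≤ C)
    (hlim : ∀ᵐ x ∂μ, Tendsto (fun k => f k x) atTop (𝓝 (g x))) : Integrable g μ := by
  refine ⟨aestronglyMeasurable_of_tendsto_ae _ (fun k => (hf k).1) hlim, ?_⟩
  have h1 : ∫⁻ x, ‖g x‖ₑ ∂μ ≤ liminf (fun k => ∫⁻ x, ‖f k x‖ₑ ∂μ) atTop := by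
    rw [lintegral_congr_ae (hlim.mono fun x hx => hx.enorm.liminf_eq.symm)]
    exact lintegral_liminf_le' fun k => (hf k).1.enorm
  refine (h1.trans ?_).trans_lt (ENNReal.ofReal_lt_top (r := C))
  refine liminf_le_of_frequently_le' (Frequently.of_forall fun k => ?_)
  rw [← ofReal_integral_norm_eq_lintegral_enorm (hf k)]
  refine ENNReal.ofReal_le_ofReal (le_trans (le_of_eq ?_) (hC k))
  exact integral_congr_ae ((h0 k).mono fun x hx => Real.norm_of_nonneg hx)

/-- The weighted energy estimate: a function vanishing on the unit sphere with bounded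
`A`-divergence differs from a radial multiple of `radialGap` by a small error near the sphere. -/
lemma integrableOn_sq_div_radialGap (hA : ∀ i j, BddMeas fun x => A x i j)
    (hdiv : ∀ (j : ι) (φ : EuclideanSpace ℝ ι → ℝ), IsTest φ →
      ∫ x in ball 0 1, grad φ x ⬝ᵥ (fun i => A x i j) = 0)
    {lam : ℝ} (hlam : 0 < lam)
    (hell : ∀ x ∈ ball 0 1, ∀ v, lam * (v ⬝ᵥ v) ≤ v ⬝ᵥ (A x *ᵥ v))
    {u : EuclideanSpace ℝ ι → ℝ} (hu : IsTest u) {C : ℝ}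
    (hC : ∀ (φ : EuclideanSpace ℝ ι → ℝ) (S : ℝ), IsTest φ →
      (∀ x ∈ ball 0 1, |φ x| ≤ S) →
      |∫ x in ball 0 1, grad φ x ⬝ᵥ (A x *ᵥ grad u x)| ≤ C * S) :
    IntegrableOn (fun x => (grad u x + (u x / radialGap x) • x.ofLp) ⬝ᵥ
      (grad u x + (u x / radialGap x) • x.ofLp) / radialGap x) (ball 0 1) := by
  obtain ⟨D, hD⟩ := exists_abs_integral_le_of_contDiff hA hdiv contDiff_radialGap
  obtain ⟨K, hK⟩ := hu.2
  let s : ℕ → ℝ := fun k => 1 / ((k : ℝ) + 1)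
  have hs : ∀ k, 0 < s k := fun k => by positivity
  let κ : ℕ → EuclideanSpace ℝ ι → ℝ := fun k x => (radialGap x + s k)⁻¹
  have hκ : ∀ k, LipOnBall (κ k) := fun k => .inv_radialGap_add (hs k)
  let δ : ℕ → EuclideanSpace ℝ ι → ι → ℝ := fun k x => grad u x + (κ k x * u x) • x.ofLp
  have hκpos : ∀ k, ∀ x ∈ ball 0 1, 0 < κ k x := fun k x hx =>
    inv_pos.mpr (add_pos (radialGap_pos hx) (hs k))
  have hδ : ∀ k i, BddMeas fun x => δ k x i := fun k i =>
    (hu.1.grad_bddMeas i).add (((hκ k).mul hu.1).bddMeas.mul (LipOnBall.coord i).bddMeas)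
  have hφ : ∀ k, IsTest fun x => κ k x * u x := fun k => hu.mul_left (hκ k)
  have hφS : ∀ k, ∀ x ∈ ball 0 1, |κ k x * u x| ≤ 2 * |K| := fun k x hx => by
    have h0 := radialGap_pos hx
    have h1 : |u x| ≤ 2 * |K| * (radialGap x + s k) := by
      have h3 := mul_le_mul_of_nonneg_right (le_abs_self K)
        (h0.le.trans (radialGap_le hx))
      have h4 := mul_le_mul_of_nonneg_left (one_sub_norm_le hx) (abs_nonneg K)
      have h5 := mul_nonneg (abs_nonneg K) (hs k).le
      linarith [hK x hx]
    rw [abs_mul, abs_of_pos (hκpos k x hx), inv_mul_le_iff₀ (add_pos h0 (hs k))]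
    linarith
  have hmain : ∀ k, ∫ x in ball 0 1, κ k x * (δ k x ⬝ᵥ (A x *ᵥ δ k x)) ≤
      C * (2 * |K|) + 1 / 2 * (D * ((2 * |K|) * (2 * |K|))) := fun k => by
    have h1 := (abs_le.mp (hC _ _ (hφ k) (hφS k))).2
    have h2 := (abs_le.mp (hD _ _ ((hφ k).mul_left (hφ k).1) fun x hx => by
      rw [abs_mul]
      exact mul_le_mul (hφS k x hx) (hφS k x hx) (abs_nonneg _) (by positivity))).1
    have hgr : ∀ᵐ x ∂(volume.restrict (ball 0 1)), κ k x * (δ k x ⬝ᵥ (A x *ᵥ δ k x)) =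
        grad (fun y => κ k y * u y) x ⬝ᵥ (A x *ᵥ grad u x) -
          1 / 2 * (grad (fun y => κ k y * u y * (κ k y * u y)) x ⬝ᵥ
            (A x *ᵥ grad radialGap x)) := by
      filter_upwards [hu.1.ae_differentiableAt, (hκ k).ae_differentiableAt,
        ae_restrict_mem measurableSet_ball] with x hux hκx hx
      have e1 : grad (fun y => κ k y * u y) x = κ k x • δ k x := by
        have : grad (κ k) x = κ k x ^ 2 • x.ofLp := grad_inv_radialGap_add (hs k) hx
        rw [grad_mul hκx hux, this]
        simp only [δ, smul_add, smul_smul]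
        congr 2
        ring
      have hd : DifferentiableAt ℝ (fun y => κ k y * u y) x := hκx.mul hux
      rw [grad_mul hd hd, e1, grad_radialGap]
      simp only [δ, mulVec_add, mulVec_smul, mulVec_neg, smul_dotProduct, dotProduct_add,
        add_dotProduct, dotProduct_smul, dotProduct_neg, smul_eq_mul]
      ring
    have hi1 : IntegrableOn (fun x => grad (fun y => κ k y * u y) x ⬝ᵥ (A x *ᵥ grad u x))
        (ball 0 1) := (BddMeas.dotProduct (hφ k).1.grad_bddMeas
          (BddMeas.mulVec hA hu.1.grad_bddMeas)).integrableOn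
    have hi2 : IntegrableOn (fun x => grad (fun y => κ k y * u y * (κ k y * u y)) x ⬝ᵥ
        (A x *ᵥ grad radialGap x)) (ball 0 1) :=
      (BddMeas.dotProduct ((hφ k).mul_left (hφ k).1).1.grad_bddMeas
        (BddMeas.mulVec hA isTest_radialGap.1.grad_bddMeas)).integrableOn
    rw [integral_congr_ae hgr, integral_sub hi1 (hi2.const_mul _), integral_const_mul]
    linarith
  have hint : ∀ k, IntegrableOn (fun x => κ k x * (δ k x ⬝ᵥ δ k x)) (ball 0 1) := fun k =>
    ((hκ k).bddMeas.mul (.dotProduct (hδ k) (hδ k))).integrableOn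
  have hintA : ∀ k, IntegrableOn (fun x => κ k x * (δ k x ⬝ᵥ (A x *ᵥ δ k x))) (ball 0 1) :=
    fun k => ((hκ k).bddMeas.mul (.dotProduct (hδ k) (.mulVec hA (hδ k)))).integrableOn
  refine integrable_of_tendsto_of_integral_le hint
    (C := lam⁻¹ * (C * (2 * |K|) + 1 / 2 * (D * ((2 * |K|) * (2 * |K|))))) (fun k => ?_)
    (fun k => ?_) ?_
  · filter_upwards [ae_restrict_mem measurableSet_ball] with x hx
    exact mul_nonneg (hκpos k x hx).le (Finset.sum_nonneg fun i _ => mul_self_nonneg _)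
  · rw [← div_eq_inv_mul, le_div_iff₀' hlam, ← integral_const_mul]
    refine (integral_mono_ae ((hint k).const_mul lam) (hintA k) ?_).trans (hmain k)
    filter_upwards [ae_restrict_mem measurableSet_ball] with x hx
    have := mul_le_mul_of_nonneg_left (hell x hx (δ k x)) (hκpos k x hx).le
    linarith
  · filter_upwards [ae_restrict_mem measurableSet_ball] with x hx
    have h0 := (radialGap_pos hx).ne'
    have hsl : Tendsto s atTop (𝓝 0) := tendsto_one_div_add_atTop_nhds_zero_nat
    have hκl : Tendsto (fun k => κ k x) atTop (𝓝 (radialGap x)⁻¹) := by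
      have := (hsl.const_add (radialGap x)).inv₀ (by rwa [add_zero])
      rwa [add_zero] at this
    have hδl : Tendsto (fun k => δ k x) atTop
        (𝓝 (grad u x + (u x / radialGap x) • x.ofLp)) := by
      refine tendsto_const_nhds.add (Tendsto.smul_const ?_ _)
      rw [div_eq_inv_mul]
      exact hκl.mul_const _
    have hdd : Continuous fun v : ι → ℝ => v ⬝ᵥ v := by
      simp only [dotProduct]
      fun_prop
    rw [div_eq_inv_mul]
    exact hκl.mul ((hdd.tendsto _).comp hδl)

end Energy

section Radial

lemma integral_grad_apply_eq_zero {φ : EuclideanSpace ℝ ι → ℝ} (hφ : IsTest φ) (j : ι) :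
    ∫ x in ball 0 1, grad φ x ⬝ᵥ (fun i => (1 : Matrix ι ι ℝ) i j) = 0 := by
  refine integral_eq_zero_of_isTest (b := fun _ i => (1 : Matrix ι ι ℝ) i j)
    (fun i => .const _) (fun ψ h1 h2 h3 => ?_) hφ
  have hψ : ∀ x, grad ψ x ⬝ᵥ (fun i => (1 : Matrix ι ι ℝ) i j) =
      fderiv ℝ ψ x (EuclideanSpace.single j 1) := fun x => by
    simp [dotProduct, Matrix.one_apply, grad]
  have hd : Differentiable ℝ ψ := h1.differentiable (by simp)
  have hcd : HasCompactSupport fun x => fderiv ℝ ψ x (EuclideanSpace.single j 1) :=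
    h2.fderiv_apply ℝ _
  have hc : Continuous fun x => fderiv ℝ ψ x (EuclideanSpace.single j 1) :=
    (h1.continuous_fderiv (by simp)).clm_apply continuous_const
  simp only [hψ]
  rw [setIntegral_eq_integral_of_forall_compl_eq_zero fun x hx => by
    rw [fderiv_of_notMem_tsupport ℝ fun h => hx (h3 h)]; simp]
  have := integral_mul_fderiv_eq_neg_fderiv_mul_of_integrable (μ := volume)
    (f := fun _ : EuclideanSpace ℝ ι => (1 : ℝ)) (g := ψ) (v := EuclideanSpace.single j 1)
    (by simp) (by simpa using hc.integrable_of_hasCompactSupport hcd)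
    (by simpa using h1.continuous.integrable_of_hasCompactSupport h2)
    (fun x _ => differentiableAt_const _) fun x _ => hd x
  simpa using this

/-- The density `-∂ψ/∂h` for the cutoff `ψ = h / (h + s)`, `h = radialGap`. -/
noncomputable def cutoffDensity (s : ℝ) (x : EuclideanSpace ℝ ι) : ℝ :=
  s * (radialGap x + s)⁻¹ ^ 2

variable {s : ℝ}

omit [DecidableEq ι] in
lemma isTest_cutoff (hs : 0 < s) :
    IsTest fun x : EuclideanSpace ℝ ι => (radialGap x + s)⁻¹ * radialGap x :=
  isTest_radialGap.mul_left (.inv_radialGap_add hs)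

omit [DecidableEq ι] in
lemma bddMeas_cutoffDensity (hs : 0 < s) :
    BddMeas (cutoffDensity s : EuclideanSpace ℝ ι → ℝ) := by
  have h := (LipOnBall.inv_radialGap_add (ι := ι) hs).bddMeas
  unfold cutoffDensity
  simpa only [sq] using (BddMeas.const s).mul (h.mul h)

lemma grad_cutoff (hs : 0 < s) {x : EuclideanSpace ℝ ι} (hx : x ∈ ball 0 1) :
    grad (fun y => (radialGap y + s)⁻¹ * radialGap y) x = -(cutoffDensity s x • x.ofLp) := by
  have h0 : radialGap x + s ≠ 0 := (add_pos (radialGap_pos hx) hs).ne'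
  have hd : DifferentiableAt ℝ (fun y => (radialGap y + s)⁻¹) x :=
    ((differentiableAt_radialGap x).add_const s).inv h0
  rw [grad_mul hd (differentiableAt_radialGap x), grad_inv_radialGap_add hs hx, grad_radialGap,
    smul_neg, smul_smul, ← neg_smul, ← add_smul, ← neg_smul, cutoffDensity]
  congr 1
  field_simp
  ring

omit [DecidableEq ι] in
lemma cutoffDensity_nonneg (hs : 0 < s) (x : EuclideanSpace ℝ ι) : 0 ≤ cutoffDensity s x := by
  unfold cutoffDensity
  positivity

omit [DecidableEq ι] in
lemma cutoff_mem_Icc (hs : 0 < s) {x : EuclideanSpace ℝ ι} (hx : x ∈ ball 0 1) :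
    (radialGap x + s)⁻¹ * radialGap x ∈ Icc (0 : ℝ) 1 := by
  have h := radialGap_pos hx
  refine ⟨by positivity, ?_⟩
  rw [inv_mul_le_iff₀ (by positivity)]
  linarith

omit [DecidableEq ι] in
lemma cutoffDensity_mul_radialGap_le (hs : 0 < s) {x : EuclideanSpace ℝ ι} (hx : x ∈ ball 0 1) :
    cutoffDensity s x * radialGap x ≤ 1 / 4 := by
  have h := radialGap_pos hx
  rw [cutoffDensity, inv_pow, mul_right_comm, ← div_eq_mul_inv, div_le_iff₀ (by positivity)]
  nlinarith [sq_nonneg (radialGap x - s)]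

lemma grad_coord_dotProduct_sum (A : Matrix ι ι ℝ) (x : EuclideanSpace ℝ ι) :
    ∑ j, grad (fun y : EuclideanSpace ℝ ι => y j) x ⬝ᵥ (fun i => A i j) = A.trace := by
  simp [grad_coord, Matrix.trace]

lemma integral_cutoffDensity_le (hs : 0 < s) :
    ∫ x in ball (0 : EuclideanSpace ℝ ι) 1, cutoffDensity s x ≤
      (Fintype.card ι + 1) * volume.real (ball (0 : EuclideanSpace ℝ ι) 1) := by
  have h1 := integral_divergence_eq_zero (A := fun _ => (1 : Matrix ι ι ℝ)) (fun i j => .const _)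
    (fun j φ hφ => integral_grad_apply_eq_zero hφ j) LipOnBall.coord
    (isTest_cutoff hs)
  simp only [grad_coord_dotProduct_sum, one_mulVec, trace_one] at h1
  have hint : IntegrableOn (fun x : EuclideanSpace ℝ ι =>
      grad (fun y => (radialGap y + s)⁻¹ * radialGap y) x ⬝ᵥ x.ofLp +
        (radialGap x + s)⁻¹ * radialGap x * Fintype.card ι) (ball 0 1) :=
    ((BddMeas.dotProduct (isTest_cutoff hs).1.grad_bddMeas
      fun i => (LipOnBall.coord i).bddMeas).add
        ((isTest_cutoff hs).1.bddMeas.mul (.const _))).integrableOn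
  have hc : IntegrableOn (fun _ : EuclideanSpace ℝ ι => (Fintype.card ι + 1 : ℝ)) (ball 0 1) :=
    integrableOn_const measure_ball_lt_top.ne
  have h2 := setIntegral_mono_on (bddMeas_cutoffDensity (ι := ι) hs).integrableOn
    (hc.sub hint) measurableSet_ball fun x hx => by
      have e1 : x.ofLp ⬝ᵥ x.ofLp = 1 - 2 * radialGap x := by
        rw [radialGap, EuclideanSpace.real_norm_sq_eq]
        simp only [dotProduct, sq]
        ring
      have e2 := cutoffDensity_mul_radialGap_le hs hx
      have e3 := mul_le_mul_of_nonneg_right (cutoff_mem_Icc hs hx).2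
        (Nat.cast_nonneg (α := ℝ) (Fintype.card ι))
      simp only [Pi.sub_apply]
      rw [grad_cutoff hs hx, neg_dotProduct, smul_dotProduct, smul_eq_mul, e1]
      linarith
  rw [integral_sub' hc hint, h1, sub_zero, setIntegral_const, smul_eq_mul, mul_comm] at h2
  exact h2

/-- A limiting argument turning the radial flux identity into a bound for the integral of `p`. -/
lemma mul_integral_le_of_flux {p G e : EuclideanSpace ℝ ι → ℝ} {N P Q : ℝ}
    (hp : IntegrableOn p (ball 0 1)) (hG : BddMeas G) (he : IntegrableOn e (ball 0 1))
    (hP : 0 ≤ P)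
    (hflux : ∀ s : ℝ, 0 < s → N * ∫ x in ball 0 1, (radialGap x + s)⁻¹ * radialGap x * p x =
      ∫ x in ball 0 1, cutoffDensity s x * G x)
    (hGle : ∀ᵐ x ∂(volume.restrict (ball 0 1)), G x ≤ P + Q * (radialGap x * e x)) :
    N * ∫ x in ball 0 1, p x ≤
      P * ((Fintype.card ι + 1) * volume.real (ball (0 : EuclideanSpace ℝ ι) 1)) := by
  let s : ℕ → ℝ := fun k => 1 / ((k : ℝ) + 1)
  have hs : ∀ k, 0 < s k := fun k => by positivity
  have hsl : Tendsto s atTop (𝓝 0) := tendsto_one_div_add_atTop_nhds_zero_nat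
  have hκl : ∀ x ∈ ball (0 : EuclideanSpace ℝ ι) 1,
      Tendsto (fun k => (radialGap x + s k)⁻¹) atTop (𝓝 (radialGap x)⁻¹) := fun x hx => by
    have := (hsl.const_add (radialGap x)).inv₀ (by rw [add_zero]; exact (radialGap_pos hx).ne')
    rwa [add_zero] at this
  have hbound : ∀ k, ∀ x ∈ ball (0 : EuclideanSpace ℝ ι) 1,
      ‖cutoffDensity (s k) x * (radialGap x * e x)‖ ≤ ‖e x‖ := fun k x hx => by
    have h1 := cutoffDensity_mul_radialGap_le (hs k) hx
    have h2 := mul_nonneg (cutoffDensity_nonneg (hs k) x) (radialGap_pos hx).le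
    rw [← mul_assoc, norm_mul, Real.norm_of_nonneg h2]
    exact mul_le_of_le_one_left (norm_nonneg _) (by linarith)
  have hmeas : ∀ k, AEStronglyMeasurable
      (fun x => cutoffDensity (s k) x * (radialGap x * e x)) (volume.restrict (ball 0 1)) :=
    fun k => (bddMeas_cutoffDensity (hs k)).1.mul (isTest_radialGap.1.bddMeas.1.mul he.1)
  have hint : ∀ k, IntegrableOn
      (fun x => cutoffDensity (s k) x * (radialGap x * e x)) (ball 0 1) := fun k =>
    he.norm.mono' (hmeas k) <| by
      filter_upwards [ae_restrict_mem measurableSet_ball] with x hx using hbound k x hx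
  have hleft : Tendsto (fun k => N * ∫ x in ball 0 1,
      (radialGap x + s k)⁻¹ * radialGap x * p x) atTop (𝓝 (N * ∫ x in ball 0 1, p x)) := by
    refine (tendsto_integral_of_dominated_convergence (fun x => ‖p x‖) (fun k => ?_) hp.norm
      (fun k => ?_) ?_).const_mul N
    · exact (isTest_cutoff (hs k)).1.bddMeas.1.mul hp.1
    · filter_upwards [ae_restrict_mem measurableSet_ball] with x hx
      have h := cutoff_mem_Icc (hs k) hx
      rw [norm_mul, Real.norm_of_nonneg h.1]
      exact mul_le_of_le_one_left (norm_nonneg _) h.2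
    · filter_upwards [ae_restrict_mem measurableSet_ball] with x hx
      have := ((hκl x hx).mul_const (radialGap x)).mul_const (p x)
      rwa [inv_mul_cancel₀ (radialGap_pos hx).ne', one_mul] at this
  have herr : Tendsto (fun k => ∫ x in ball 0 1, cutoffDensity (s k) x * (radialGap x * e x))
      atTop (𝓝 0) := by
    have := tendsto_integral_of_dominated_convergence (f := fun _ => (0 : ℝ))
      (fun x => ‖e x‖) hmeas he.norm (fun k => by
        filter_upwards [ae_restrict_mem measurableSet_ball] with x hx using hbound k x hx) (by
        filter_upwards [ae_restrict_mem measurableSet_ball] with x hx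
        have := (hsl.mul ((hκl x hx).pow 2)).mul_const (radialGap x * e x)
        rwa [zero_mul, zero_mul] at this)
    rwa [integral_zero] at this
  have hright := (herr.const_mul Q).const_add
    (P * ((Fintype.card ι + 1) * volume.real (ball (0 : EuclideanSpace ℝ ι) 1)))
  rw [mul_zero, add_zero] at hright
  refine le_of_tendsto_of_tendsto' hleft hright fun k => ?_
  have hcd := (bddMeas_cutoffDensity (ι := ι) (hs k)).integrableOn
  rw [hflux _ (hs k)]
  calc ∫ x in ball 0 1, cutoffDensity (s k) x * G x
      ≤ ∫ x in ball 0 1, (P * cutoffDensity (s k) x +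
          Q * (cutoffDensity (s k) x * (radialGap x * e x))) := by
        refine integral_mono_ae ((bddMeas_cutoffDensity (hs k)).mul hG).integrableOn
          ((hcd.const_mul P).add ((hint k).const_mul Q)) ?_
        filter_upwards [hGle] with x hx
        have := mul_le_mul_of_nonneg_left hx (cutoffDensity_nonneg (hs k) x)
        linarith
    _ = P * (∫ x in ball 0 1, cutoffDensity (s k) x) +
          Q * ∫ x in ball 0 1, cutoffDensity (s k) x * (radialGap x * e x) := by
        rw [integral_add (hcd.const_mul P) ((hint k).const_mul Q), integral_const_mul,
          integral_const_mul]
    _ ≤ _ := by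
        gcongr
        exact integral_cutoffDensity_le (hs k)

end Radial

section WeakSolution

variable {κ : Type*} [Fintype κ]

/-- The Jacobian matrix of the map with components `f`. -/
noncomputable def jacobian (f : κ → EuclideanSpace ℝ ι → ℝ) (x : EuclideanSpace ℝ ι) :
    Matrix κ ι ℝ :=
  Matrix.of fun α => grad (f α) x

/-- The coefficients `√g g⁻¹` of the minimal surface system, where `g = 1 + MᵀM`. -/
noncomputable def areaCoeff (M : Matrix κ ι ℝ) : Matrix ι ι ℝ :=
  √(1 + Mᵀ * M).det • (1 + Mᵀ * M)⁻¹

/-- Lipschitz weak solutions of the minimal surface system on the unit ball. -/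
structure IsWeakSolution (f : κ → EuclideanSpace ℝ ι → ℝ) : Prop where
  lipOnBall : ∀ α, LipOnBall (f α)
  integral_column : ∀ (j : ι) (φ : EuclideanSpace ℝ ι → ℝ), IsTest φ →
    ∫ x in ball 0 1, grad φ x ⬝ᵥ (fun i => areaCoeff (jacobian f x) i j) = 0
  integral_component : ∀ (α : κ) (φ : EuclideanSpace ℝ ι → ℝ), IsTest φ →
    ∫ x in ball 0 1, grad φ x ⬝ᵥ (areaCoeff (jacobian f x) *ᵥ grad (f α) x) = 0

lemma one_le_det_one_add_transpose_mul (M : Matrix κ ι ℝ) : 1 ≤ (1 + Mᵀ * M).det := by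
  have h := posSemidef_conjTranspose_mul_self M
  rw [conjTranspose_eq_transpose_of_trivial] at h
  exact one_le_det_one_add h

omit [DecidableEq ι] in
lemma mulVec_dotProduct_mulVec_le (M : Matrix κ ι ℝ) (v : ι → ℝ) :
    (M *ᵥ v) ⬝ᵥ (M *ᵥ v) ≤ (∑ α, M α ⬝ᵥ M α) * (v ⬝ᵥ v) := by
  rw [Finset.sum_mul]
  refine Finset.sum_le_sum fun α _ => ?_
  have := Finset.sum_mul_sq_le_sq_mul_sq Finset.univ (M α) v
  simpa only [mulVec, dotProduct, sq] using this

lemma areaCoeff_elliptic {M : Matrix κ ι ℝ} {K : ℝ} (hM : ∑ α, M α ⬝ᵥ M α ≤ K) (v : ι → ℝ) :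
    (1 + K)⁻¹ * (v ⬝ᵥ v) ≤ v ⬝ᵥ (areaCoeff M *ᵥ v) := by
  have hK : 0 ≤ K := (Finset.sum_nonneg fun α _ =>
    Finset.sum_nonneg fun i _ => mul_self_nonneg (M α i)).trans hM
  have hv : 0 ≤ v ⬝ᵥ v := Finset.sum_nonneg fun i _ => mul_self_nonneg (v i)
  have h1 := dotProduct_self_le_inv hK
    (fun w => (mulVec_dotProduct_mulVec_le M w).trans (mul_le_mul_of_nonneg_right hM
      (Finset.sum_nonneg fun i _ => mul_self_nonneg (w i)))) v
  rw [← inv_mul_le_iff₀ (by positivity)] at h1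
  rw [areaCoeff, smul_mulVec, dotProduct_smul, smul_eq_mul]
  refine h1.trans (le_mul_of_one_le_left ((by positivity : (0 : ℝ) ≤ _).trans h1) ?_)
  exact Real.one_le_sqrt.mpr (one_le_det_one_add_transpose_mul M)

lemma trace_areaCoeff_add (M : Matrix κ ι ℝ) :
    (areaCoeff M).trace + ∑ α, M α ⬝ᵥ (areaCoeff M *ᵥ M α) =
      Fintype.card ι * √(1 + Mᵀ * M).det := by
  have h1 : ∑ α, M α ⬝ᵥ (areaCoeff M *ᵥ M α) = (areaCoeff M * (Mᵀ * M)).trace := by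
    rw [← Matrix.mul_assoc, trace_mul_comm, Matrix.trace]
    rfl
  rw [h1, ← trace_add]
  nth_rw 1 [← Matrix.mul_one (areaCoeff M)]
  rw [← Matrix.mul_add, areaCoeff, Matrix.smul_mul, nonsing_inv_mul _
    ((isUnit_iff_isUnit_det _).mp (posDef_one_add_transpose_mul M).isUnit), trace_smul, trace_one,
    smul_eq_mul, mul_comm]

lemma dotProduct_areaCoeff_mulVec_le (M : Matrix κ ι ℝ) (x : ι → ℝ) (f : κ → ℝ) {q B : ℝ}
    (hx : x ⬝ᵥ x ≤ 1) (hq0 : 0 ≤ q) (hB : 0 ≤ B)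
    (hq : (1 + Mᵀ * M).det * (x ⬝ᵥ ((1 + Mᵀ * M)⁻¹ *ᵥ x)) ≤ q ^ 2)
    (hf : f ⬝ᵥ f ≤ B ^ 2) :
    x ⬝ᵥ (areaCoeff M *ᵥ (x + Mᵀ *ᵥ f)) ≤ q * (1 + B) := by
  have h0 := one_le_det_one_add_transpose_mul M
  have h2 := sq_dotProduct_inv_mulVec_le M x f
  have hS : 0 ≤ x ⬝ᵥ x + f ⬝ᵥ f := add_nonneg (Finset.sum_nonneg fun i _ => mul_self_nonneg (x i))
    (Finset.sum_nonneg fun i _ => mul_self_nonneg (f i))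
  rw [areaCoeff, smul_mulVec, dotProduct_smul, smul_eq_mul]
  refine (le_abs_self _).trans (abs_le_of_sq_le_sq ?_ (by positivity))
  rw [mul_pow, Real.sq_sqrt (zero_le_one.trans h0), mul_pow]
  calc _ ≤ _ := mul_le_mul_of_nonneg_left h2 (zero_le_one.trans h0)
    _ ≤ q ^ 2 * (x ⬝ᵥ x + f ⬝ᵥ f) := by
      rw [← mul_assoc]
      exact mul_le_mul_of_nonneg_right hq hS
    _ ≤ q ^ 2 * (1 + B) ^ 2 := mul_le_mul_of_nonneg_left (by nlinarith) (sq_nonneg q)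

namespace IsWeakSolution

variable {f : κ → EuclideanSpace ℝ ι → ℝ}

lemma bddMeas_metric (hf : ∀ α, LipOnBall (f α)) (i j : ι) :
    BddMeas fun x => (1 + (jacobian f x)ᵀ * jacobian f x : Matrix ι ι ℝ) i j := by
  simp only [Matrix.add_apply, Matrix.mul_apply, Matrix.transpose_apply]
  exact (BddMeas.const _).add
    (.sum _ fun α _ => ((hf α).grad_bddMeas i).mul ((hf α).grad_bddMeas j))

lemma bddMeas_sqrt_det (hf : ∀ α, LipOnBall (f α)) :
    BddMeas fun x => √(1 + (jacobian f x)ᵀ * jacobian f x).det :=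
  (BddMeas.det (bddMeas_metric hf)).sqrt

lemma bddMeas_areaCoeff (hf : ∀ α, LipOnBall (f α)) (i j : ι) :
    BddMeas fun x => areaCoeff (jacobian f x) i j := by
  simp only [areaCoeff, Matrix.smul_apply, Matrix.inv_def, Ring.inverse_eq_inv', smul_eq_mul]
  exact (bddMeas_sqrt_det hf).mul
    (((BddMeas.det (bddMeas_metric hf)).inv fun x => one_le_det_one_add_transpose_mul _).mul
      (BddMeas.adjugate (bddMeas_metric hf) i j))

lemma integral_area (hf : IsWeakSolution f) {ψ : EuclideanSpace ℝ ι → ℝ} (hψ : IsTest ψ) :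
    ∫ x in ball 0 1, (grad ψ x ⬝ᵥ (areaCoeff (jacobian f x) *ᵥ
      (x.ofLp + (jacobian f x)ᵀ *ᵥ fun α => f α x)) +
      ψ x * (Fintype.card ι * √(1 + (jacobian f x)ᵀ * jacobian f x).det)) = 0 := by
  have hA := bddMeas_areaCoeff hf.lipOnBall
  have h1 := integral_divergence_eq_zero hA hf.integral_column LipOnBall.coord hψ
  simp only [grad_coord_dotProduct_sum] at h1
  have h2 : ∫ x in ball 0 1, ∑ α, grad (fun y => f α y * ψ y) x ⬝ᵥ
      (areaCoeff (jacobian f x) *ᵥ grad (f α) x) = 0 := by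
    rw [integral_finsetSum]
    · exact Finset.sum_eq_zero fun α _ =>
        hf.integral_component α _ (hψ.mul_left (hf.lipOnBall α))
    · exact fun α _ => (BddMeas.dotProduct (hψ.mul_left (hf.lipOnBall α)).1.grad_bddMeas
        (BddMeas.mulVec hA (hf.lipOnBall α).grad_bddMeas)).integrableOn
  have h3 : ∀ᵐ x ∂(volume.restrict (ball 0 1)), ∀ α, DifferentiableAt ℝ (f α) x :=
    ae_all_iff.mpr fun α => (hf.lipOnBall α).ae_differentiableAt
  refine Eq.trans ?_ ((congrArg₂ (· + ·) h1 h2).trans (add_zero 0))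
  rw [← integral_add]
  · refine integral_congr_ae ?_
    filter_upwards [h3, hψ.1.ae_differentiableAt] with x hfx hψx
    rw [← trace_areaCoeff_add, mulVec_transpose, vecMul_eq_sum, mulVec_add, dotProduct_add,
      mulVec_sum, dotProduct_sum, mul_add, Finset.mul_sum, add_add_add_comm,
      ← Finset.sum_add_distrib]
    congr 1
    refine Finset.sum_congr rfl fun α _ => ?_
    rw [grad_mul (hfx α) hψx, add_dotProduct, smul_dotProduct, smul_dotProduct, mulVec_smul,
      dotProduct_smul]
    rfl
  · exact ((BddMeas.dotProduct hψ.1.grad_bddMeas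
      (BddMeas.mulVec hA fun i => (LipOnBall.coord i).bddMeas)).add
        (hψ.1.bddMeas.mul (.sum _ fun i _ => hA i i))).integrableOn
  · exact (BddMeas.sum _ fun α _ =>
      (BddMeas.dotProduct (hψ.mul_left (hf.lipOnBall α)).1.grad_bddMeas
        (BddMeas.mulVec hA (hf.lipOnBall α).grad_bddMeas))).integrableOn

end IsWeakSolution

end WeakSolution

section MassBound

variable {κ : Type*} [Fintype κ]

lemma one_add_pow_le {y m : ℝ} (N : ℕ) (hy : 0 ≤ y) (hm : y ≤ m) :
    (1 + y) ^ N ≤ 1 + N * (1 + m) ^ N * y := by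
  induction N with
  | zero => simp
  | succ N ih =>
    have h1 : (1 + y) ^ N ≤ (1 + m) ^ N := by gcongr
    have h2 : (1 + m) ^ N ≤ (1 + m) ^ (N + 1) :=
      pow_le_pow_right₀ (by linarith) N.le_succ
    have h3 : 0 ≤ (N : ℝ) * y := by positivity
    push_cast
    rw [pow_succ (1 + y)]
    nlinarith [mul_le_mul_of_nonneg_right h1 hy, mul_le_mul_of_nonneg_right h2 hy,
      mul_le_mul_of_nonneg_right h2 h3]

omit [DecidableEq ι] in
lemma IsTest.bddMeas_div_radialGap {u : EuclideanSpace ℝ ι → ℝ} (hu : IsTest u) :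
    BddMeas fun x => u x / radialGap x := by
  obtain ⟨K, hK⟩ := hu.2
  refine ⟨(hu.1.bddMeas.1.aemeasurable.div
    isTest_radialGap.1.bddMeas.1.aemeasurable).aestronglyMeasurable, 2 * |K|, fun x hx => ?_⟩
  have h0 := radialGap_pos hx
  rw [abs_div, abs_of_pos h0, div_le_iff₀ h0]
  nlinarith [hK x hx, mul_le_mul_of_nonneg_right (le_abs_self K) (h0.le.trans (radialGap_le hx)),
    mul_le_mul_of_nonneg_left (one_sub_norm_le hx) (abs_nonneg K)]

lemma exists_mem_sphere_dist_le_one_sub_norm [Nonempty ι] {x : EuclideanSpace ℝ ι}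
    (hx : x ∈ ball 0 1) : ∃ y ∈ sphere (0 : EuclideanSpace ℝ ι) 1, dist x y ≤ 1 - ‖x‖ := by
  rcases eq_or_ne x 0 with rfl | h0
  · inhabit ι
    exact ⟨EuclideanSpace.single default 1, by simp, by simp⟩
  · have hn : 0 < ‖x‖ := norm_pos_iff.mpr h0
    refine ⟨‖x‖⁻¹ • x, by simp [norm_smul, hn.ne'], ?_⟩
    have h1 : x - ‖x‖⁻¹ • x = (1 - ‖x‖⁻¹) • x := by rw [sub_smul, one_smul]
    have h2 : 1 ≤ ‖x‖⁻¹ := (one_le_inv₀ hn).mpr (mem_ball_zero_iff.mp hx).le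
    rw [dist_eq_norm, h1, norm_smul, Real.norm_of_nonpos (by linarith), neg_sub, sub_mul,
      inv_mul_cancel₀ hn.ne', one_mul]

lemma exists_mem_sphere_dist_le [Nonempty ι] {x : EuclideanSpace ℝ ι} (hx : x ∈ ball 0 1) :
    ∃ y ∈ sphere (0 : EuclideanSpace ℝ ι) 1, dist x y ≤ 2 * radialGap x :=
  let ⟨y, hy, hd⟩ := exists_mem_sphere_dist_le_one_sub_norm hx
  ⟨y, hy, hd.trans (one_sub_norm_le hx)⟩

/-- The integrability of the deviation of the Jacobian of a weak solution from a rank one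
perturbation of the Jacobian of its boundary data. -/
lemma IsWeakSolution.integrableOn_deviation {f η : κ → EuclideanSpace ℝ ι → ℝ} {R : ℝ}
    (hf : IsWeakSolution f) (hη : ∀ α, ContDiff ℝ 2 (η α))
    {u : κ → EuclideanSpace ℝ ι → ℝ} (hu_eq : ∀ α x, u α x = f α x - R * η α x)
    (hu : ∀ α, IsTest (u α)) (α : κ) :
    IntegrableOn (fun x => (grad (u α) x + (u α x / radialGap x) • x.ofLp) ⬝ᵥ
      (grad (u α) x + (u α x / radialGap x) • x.ofLp) / radialGap x) (ball 0 1) := by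
  have hA := bddMeas_areaCoeff hf.lipOnBall
  obtain ⟨K, hK⟩ := (BddMeas.sum Finset.univ fun α _ => BddMeas.dotProduct
    (hf.lipOnBall α).grad_bddMeas (hf.lipOnBall α).grad_bddMeas).2
  have hK0 : 0 ≤ K := (abs_nonneg _).trans (hK 0 (mem_ball_self one_pos))
  obtain ⟨C, hC⟩ := exists_abs_integral_le_of_contDiff hA hf.integral_column (hη α)
  refine integrableOn_sq_div_radialGap hA hf.integral_column (lam := (1 + K)⁻¹) (by positivity)
    (fun x hx v => areaCoeff_elliptic ((le_abs_self _).trans (hK x hx)) v) (hu α)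
    (C := |R| * C) fun φ S hφ hS => ?_
  have hηL : LipOnBall (η α) := .of_contDiff ((hη α).of_le one_le_two)
  have hint : ∀ {w : EuclideanSpace ℝ ι → ℝ}, LipOnBall w → IntegrableOn
      (fun x => grad φ x ⬝ᵥ (areaCoeff (jacobian f x) *ᵥ grad w x)) (ball 0 1) := fun hw =>
    (BddMeas.dotProduct hφ.1.grad_bddMeas (BddMeas.mulVec hA hw.grad_bddMeas)).integrableOn
  have hae : ∀ᵐ x ∂(volume.restrict (ball 0 1)),
      grad φ x ⬝ᵥ (areaCoeff (jacobian f x) *ᵥ grad (u α) x) =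
        grad φ x ⬝ᵥ (areaCoeff (jacobian f x) *ᵥ grad (f α) x) -
          R * (grad φ x ⬝ᵥ (areaCoeff (jacobian f x) *ᵥ grad (η α) x)) := by
    filter_upwards [(hf.lipOnBall α).ae_differentiableAt, hηL.ae_differentiableAt] with x h1 h2
    rw [funext (hu_eq α), grad_sub h1 (h2.const_mul R), grad_const_mul R h2, mulVec_sub,
      dotProduct_sub, mulVec_smul, dotProduct_smul, smul_eq_mul]
  rw [integral_congr_ae hae, integral_sub (hint (hf.lipOnBall α)) ((hint hηL).const_mul R),
    hf.integral_component α φ hφ, integral_const_mul, zero_sub, abs_neg, abs_mul, mul_assoc]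
  exact mul_le_mul_of_nonneg_left (hC φ S hφ hS) (abs_nonneg R)

end MassBound

section MassBound

variable {κ : Type*} [Fintype κ]

omit [DecidableEq ι] in
lemma sq_add_le_two_mul (v w : ι → ℝ) :
    (v + w) ⬝ᵥ (v + w) ≤ 2 * (v ⬝ᵥ v) + 2 * (w ⬝ᵥ w) := by
  have h : 0 ≤ (v - w) ⬝ᵥ (v - w) := Finset.sum_nonneg fun i _ => mul_self_nonneg _
  simp only [dotProduct_add, add_dotProduct, dotProduct_sub, sub_dotProduct] at h ⊢
  linarith

/-- Pointwise bound for the flux density of a map which is, to first order, a rank one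
perturbation of a map of rank at most `l`. -/
lemma flux_le {M L δ E : Matrix κ ι ℝ} {a f : κ → ℝ} {x : ι → ℝ} {l : ℕ} {R c d B b : ℝ}
    (hR : 1 ≤ R) (hx : x ⬝ᵥ x ≤ 1) (hM : M = R • L + (δ + E) + vecMulVec a x) (hL : L.rank ≤ l)
    (hc : ∑ α, L α ⬝ᵥ L α ≤ c) (hd : ∑ α, (2 * (δ α ⬝ᵥ δ α) + 2 * (E α ⬝ᵥ E α)) ≤ d)
    (hb : (1 + 4 * d) ^ Fintype.card ι ≤ 1 + b * d) (hB : 0 ≤ B) (hf : f ⬝ᵥ f ≤ B ^ 2) :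
    x ⬝ᵥ (areaCoeff M *ᵥ (x + Mᵀ *ᵥ f)) ≤
      (1 + b * d) * (R ^ l * √((1 + 2 * c) ^ l)) * (1 + B) := by
  have hnn : ∀ v : ι → ℝ, 0 ≤ v ⬝ᵥ v := fun v => Finset.sum_nonneg fun i _ => mul_self_nonneg _
  have hc0 : 0 ≤ c := (Finset.sum_nonneg fun α _ => hnn (L α)).trans hc
  have hd0 : 0 ≤ d := (Finset.sum_nonneg fun α _ =>
    add_nonneg (mul_nonneg zero_le_two (hnn (δ α))) (mul_nonneg zero_le_two (hnn (E α)))).trans hd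
  have h1 : 1 ≤ 1 + b * d := (one_le_pow₀ (by linarith)).trans hb
  refine dotProduct_areaCoeff_mulVec_le M x f hx (by positivity) hB ?_ hf
  have hrank : (R • L).rank ≤ l := by
    rwa [rank_smul_of_mem_nonZeroDivisors _ (mem_nonZeroDivisors_of_ne_zero (by positivity))]
  have hLc : ∀ v, ((R • L) *ᵥ v) ⬝ᵥ ((R • L) *ᵥ v) ≤ (R ^ 2 * c) * (v ⬝ᵥ v) := fun v => by
    rw [smul_mulVec, smul_dotProduct, dotProduct_smul, smul_eq_mul, smul_eq_mul, ← mul_assoc,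
      ← sq, mul_assoc]
    exact mul_le_mul_of_nonneg_left ((mulVec_dotProduct_mulVec_le L v).trans
      (mul_le_mul_of_nonneg_right hc (hnn v))) (sq_nonneg R)
  have hDd : ∀ v, ((δ + E) *ᵥ v) ⬝ᵥ ((δ + E) *ᵥ v) ≤ d * (v ⬝ᵥ v) := fun v =>
    (mulVec_dotProduct_mulVec_le _ v).trans (mul_le_mul_of_nonneg_right
      ((Finset.sum_le_sum fun α _ => sq_add_le_two_mul (δ α) (E α)).trans hd) (hnn v))
  have h2 := det_mul_inv_le_of_decomposition hM hrank (by positivity) hd0 hLc hDd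
  have h3 : (1 + 2 * (R ^ 2 * c)) ^ l ≤ (R ^ l) ^ 2 * (1 + 2 * c) ^ l := by
    rw [← pow_mul, mul_comm l, pow_mul, ← mul_pow]
    refine pow_le_pow_left₀ (by positivity) ?_ l
    nlinarith [one_le_pow₀ (n := 2) hR]
  calc _ ≤ _ := h2
    _ ≤ 1 * ((1 + b * d) * ((R ^ l) ^ 2 * (1 + 2 * c) ^ l)) := by gcongr
    _ ≤ (1 + b * d) ^ 2 * ((R ^ l) ^ 2 * (1 + 2 * c) ^ l) := by
      rw [one_mul]
      gcongr
      exact le_self_pow₀ h1 two_ne_zero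
    _ = _ := by rw [mul_pow, mul_pow, Real.sq_sqrt (by positivity)]

/-- The mass bound for weak solutions of the minimal surface system on the unit ball, in terms of
a `C²` extension of the boundary data whose differential has rank at most `l` on the sphere. -/
lemma IsWeakSolution.mass_le [Nonempty ι] {f η : κ → EuclideanSpace ℝ ι → ℝ} {R c₀ c₁ : ℝ} {l : ℕ}
    (hf : IsWeakSolution f) (hR : 1 ≤ R) (hη : ∀ α, ContDiff ℝ 2 (η α))
    (hfη : ∀ α, IsTest fun x => f α x - R * η α x)
    (hrank : ∀ y ∈ sphere (0 : EuclideanSpace ℝ ι) 1, (jacobian η y).rank ≤ l)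
    (hc₀ : ∀ x ∈ ball 0 1, ∑ α, |η α x| ≤ c₀)
    (hc₁ : ∀ y ∈ sphere (0 : EuclideanSpace ℝ ι) 1,
      ∑ α, jacobian η y α ⬝ᵥ jacobian η y α ≤ c₁) :
    Fintype.card ι * ∫ x in ball 0 1, √(1 + (jacobian f x)ᵀ * jacobian f x).det ≤
      (1 + R * c₀) * (R ^ l * √((1 + 2 * c₁) ^ l)) *
        ((Fintype.card ι + 1) * volume.real (ball (0 : EuclideanSpace ℝ ι) 1)) := by
  set u : κ → EuclideanSpace ℝ ι → ℝ := fun α x => f α x - R * η α x with hu_def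
  set h : EuclideanSpace ℝ ι → ℝ := radialGap with hh
  set δ : EuclideanSpace ℝ ι → Matrix κ ι ℝ := fun x => Matrix.of fun α =>
    grad (u α) x + (u α x / h x) • x.ofLp with hδ_def
  have hu : ∀ α, IsTest (u α) := hfη
  have hδint : ∀ α, IntegrableOn (fun x => δ x α ⬝ᵥ δ x α / h x) (ball 0 1) :=
    hf.integrableOn_deviation hη (fun _ _ => rfl) hu
  have hδ : ∀ α i, BddMeas fun x => δ x α i := fun α i =>
    ((hu α).1.grad_bddMeas i).add ((hu α).bddMeas_div_radialGap.mul (LipOnBall.coord i).bddMeas)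
  have hball : ∀ x ∈ ball (0 : EuclideanSpace ℝ ι) 1, h x ≤ 1 / 2 := fun x _ => by
    rw [hh, radialGap]
    linarith [sq_nonneg ‖x‖]
  have hLip : ∀ α i, ∃ K : ℝ≥0, LipschitzOnWith K (fun x => grad (η α) x i) (closedBall 0 1) :=
    fun α i => (((hη α).fderiv_right (m := 1) (by norm_num)).clm_apply
      contDiff_const).contDiffOn.exists_lipschitzOnWith one_ne_zero
        (convex_closedBall (0 : EuclideanSpace ℝ ι) 1) (isCompact_closedBall 0 1)
  choose K hK using hLip
  choose k hk using fun α => (hu α).2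
  set c : ℝ := ∑ α, ∑ i, 8 * (R * K α i) ^ 2 with hc
  have hc0 : 0 ≤ c := Finset.sum_nonneg fun α _ => Finset.sum_nonneg fun i _ => by positivity
  set Y : EuclideanSpace ℝ ι → ℝ := fun x => ∑ α, 2 * (δ x α ⬝ᵥ δ x α) + c * (h x * h x) with hY
  have hYb : BddMeas Y :=
    (BddMeas.sum _ fun α _ => (BddMeas.const 2).mul (.dotProduct (hδ α) (hδ α))).add
      ((BddMeas.const c).mul (isTest_radialGap.1.bddMeas.mul isTest_radialGap.1.bddMeas))
  have hY0 : ∀ x, 0 ≤ Y x := fun x => add_nonneg (Finset.sum_nonneg fun α _ =>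
    mul_nonneg zero_le_two (Finset.sum_nonneg fun i _ => mul_self_nonneg _))
      (mul_nonneg hc0 (mul_self_nonneg _))
  obtain ⟨m, hm⟩ := hYb.2
  have hm0 : 0 ≤ m := (abs_nonneg _).trans (hm 0 (mem_ball_self one_pos))
  set N := Fintype.card ι
  set b : ℝ := N * (1 + 4 * m) ^ N * 4 with hb
  set k' : ℝ := ∑ α, 2 * |k α| with hk'
  have hk'0 : 0 ≤ k' := Finset.sum_nonneg fun α _ => by positivity
  have hc₀0 : 0 ≤ c₀ := (Finset.sum_nonneg fun α _ => abs_nonneg _).trans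
    (hc₀ 0 (mem_ball_self one_pos))
  set T : ℝ := R ^ l * √((1 + 2 * c₁) ^ l) with hT
  have hT0 : 0 ≤ T := by positivity
  have hA := bddMeas_areaCoeff hf.lipOnBall
  have hG : BddMeas fun x => x.ofLp ⬝ᵥ (areaCoeff (jacobian f x) *ᵥ
      (x.ofLp + (jacobian f x)ᵀ *ᵥ fun α => f α x)) := by
    refine .dotProduct (fun i => (LipOnBall.coord i).bddMeas) (.mulVec hA fun i => ?_)
    exact (LipOnBall.coord i).bddMeas.add (.sum _ fun α _ =>
      ((hf.lipOnBall α).grad_bddMeas i).mul (hf.lipOnBall α).bddMeas)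
  refine mul_integral_le_of_flux (e := fun x => ∑ α, 2 * (δ x α ⬝ᵥ δ x α / h x) + (c * h x + 1))
    (Q := T * (k' + b * (1 + R * c₀ + k')))
    (G := fun x => x.ofLp ⬝ᵥ (areaCoeff (jacobian f x) *ᵥ
      (x.ofLp + (jacobian f x)ᵀ *ᵥ fun α => f α x)))
    (bddMeas_sqrt_det hf.lipOnBall).integrableOn hG ?_ (by positivity) (fun s hs => ?_) ?_
  · exact (integrable_finsetSum _ fun α _ => (hδint α).const_mul 2).add
      (((BddMeas.const c).mul isTest_radialGap.1.bddMeas).add (.const 1)).integrableOn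
  · have h1 := hf.integral_area (isTest_cutoff hs)
    rw [← integral_const_mul, ← sub_eq_zero, ← h1, ← integral_sub]
    · refine setIntegral_congr_fun measurableSet_ball fun x hx => ?_
      simp only
      rw [grad_cutoff hs hx, neg_dotProduct, smul_dotProduct, smul_eq_mul]
      ring
    · exact (((isTest_cutoff hs).1.bddMeas.mul
        (bddMeas_sqrt_det hf.lipOnBall)).integrableOn).const_mul _
    · exact ((bddMeas_cutoffDensity hs).mul hG).integrableOn
  · have hfd : ∀ᵐ x ∂(volume.restrict (ball 0 1)), ∀ α, DifferentiableAt ℝ (f α) x :=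
      ae_all_iff.mpr fun α => (hf.lipOnBall α).ae_differentiableAt
    filter_upwards [hfd, ae_restrict_mem measurableSet_ball] with x hfx hx
    obtain ⟨y, hy, hxy⟩ := exists_mem_sphere_dist_le hx
    have hpos : 0 < h x := radialGap_pos hx
    have hηd : ∀ α, DifferentiableAt ℝ (η α) x := fun α =>
      (hη α).contDiffAt.differentiableAt two_ne_zero
    set E : Matrix κ ι ℝ := R • (jacobian η x - jacobian η y) with hE
    have hdecomp : jacobian f x = R • jacobian η y + (δ x + E) +
        vecMulVec (fun α => -(u α x / h x)) x.ofLp := by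
      ext α i
      have e1 : grad (u α) x = grad (f α) x - R • grad (η α) x := by
        rw [hu_def, grad_sub (hfx α) ((hηd α).const_mul R), grad_const_mul R (hηd α)]
      simp only [jacobian, hE, hδ_def, Matrix.add_apply, Matrix.smul_apply, Matrix.sub_apply,
        Matrix.of_apply, vecMulVec_apply, e1, Pi.add_apply, Pi.sub_apply, Pi.smul_apply,
        smul_eq_mul]
      ring
    have hd : ∑ α, (2 * (δ x α ⬝ᵥ δ x α) + 2 * (E α ⬝ᵥ E α)) ≤ Y x := by
      rw [Finset.sum_add_distrib, hY]
      refine add_le_add le_rfl ?_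
      rw [hc, Finset.sum_mul]
      refine Finset.sum_le_sum fun α _ => ?_
      rw [dotProduct, Finset.mul_sum, Finset.sum_mul]
      refine Finset.sum_le_sum fun i _ => ?_
      have e1 := (hK α i).dist_le_mul x (ball_subset_closedBall hx) y
        (sphere_subset_closedBall hy)
      have e2 : |E α i| ≤ R * (K α i * (2 * h x)) := by
        simp only [hE, jacobian, Matrix.smul_apply, Matrix.sub_apply, Matrix.of_apply,
          smul_eq_mul, abs_mul, abs_of_pos (zero_lt_one.trans_le hR)]
        refine mul_le_mul_of_nonneg_left (e1.trans ?_) (zero_le_one.trans hR)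
        exact mul_le_mul_of_nonneg_left hxy (K α i).coe_nonneg
      have e3 := mul_self_le_mul_self (abs_nonneg _) e2
      rw [abs_mul_abs_self] at e3
      linarith
    have hB : (fun α => f α x) ⬝ᵥ (fun α => f α x) ≤ (R * c₀ + k' * h x) ^ 2 := by
      have e1 : ∑ α, |f α x| ≤ R * c₀ + k' * h x := by
        calc ∑ α, |f α x| ≤ ∑ α, (R * |η α x| + 2 * |k α| * h x) := by
              refine Finset.sum_le_sum fun α _ => ?_
              have e2 : |f α x| ≤ |R * η α x| + |u α x| := by
                have := abs_add_le (R * η α x) (u α x)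
                rwa [hu_def, add_sub_cancel] at this
              rw [abs_mul, abs_of_pos (zero_lt_one.trans_le hR)] at e2
              nlinarith [hk α x hx, mul_le_mul_of_nonneg_right (le_abs_self (k α))
                (hpos.le.trans (radialGap_le hx)),
                mul_le_mul_of_nonneg_left (one_sub_norm_le hx) (abs_nonneg (k α))]
          _ ≤ _ := by
              rw [Finset.sum_add_distrib, ← Finset.mul_sum, ← Finset.sum_mul]
              gcongr
              exact hc₀ x hx
      have e2 := Finset.sum_sq_le_sq_sum_of_nonneg (s := Finset.univ) (f := fun α => |f α x|)
        fun α _ => abs_nonneg _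
      calc _ = ∑ α, |f α x| ^ 2 := Finset.sum_congr rfl fun α _ => by rw [sq_abs, sq]
        _ ≤ _ := e2
        _ ≤ _ := pow_le_pow_left₀ (Finset.sum_nonneg fun α _ => abs_nonneg _) e1 2
    have hbd : (1 + 4 * Y x) ^ N ≤ 1 + b * Y x := by
      have := one_add_pow_le N (y := 4 * Y x) (m := 4 * m) (by linarith [hY0 x])
        (by linarith [le_abs_self (Y x), hm x hx])
      linarith
    have hxx : x.ofLp ⬝ᵥ x.ofLp ≤ 1 := by
      have e1 : x.ofLp ⬝ᵥ x.ofLp = 1 - 2 * h x := by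
        rw [hh, radialGap, EuclideanSpace.real_norm_sq_eq]
        simp only [dotProduct, sq]
        ring
      linarith
    have hflux := flux_le hR hxx hdecomp (hrank y hy) (hc₁ y hy) hd hbd (by positivity) hB
    have he : h x * (∑ α, 2 * (δ x α ⬝ᵥ δ x α / h x) + (c * h x + 1)) = Y x + h x := by
      rw [mul_add, Finset.mul_sum, hY]
      have : ∀ α, h x * (2 * (δ x α ⬝ᵥ δ x α / h x)) = 2 * (δ x α ⬝ᵥ δ x α) := fun α => by
        field_simp
      simp only [this]
      ring
    have hb0 : 0 ≤ b := by positivity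
    refine hflux.trans ?_
    rw [he]
    have t1 : 0 ≤ b * Y x * k' * (1 / 2 - h x) :=
      mul_nonneg (by have := hY0 x; positivity) (by linarith [hball x hx])
    have t2 : 0 ≤ b * (1 + R * c₀ + k') * h x := by positivity
    have t3 : 0 ≤ k' * Y x := mul_nonneg hk'0 (hY0 x)
    have t4 : 0 ≤ b * Y x * k' := mul_nonneg (mul_nonneg hb0 (hY0 x)) hk'0
    have : (1 + b * Y x) * (1 + (R * c₀ + k' * h x)) ≤
        (1 + R * c₀) + (k' + b * (1 + R * c₀ + k')) * (Y x + h x) := by nlinarith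
    nlinarith [mul_le_mul_of_nonneg_left this hT0]

end MassBound

section Euclidean

variable {κ : Type*} [Fintype κ]

lemma jacobian_apply {F : EuclideanSpace ℝ ι → EuclideanSpace ℝ κ} {x : EuclideanSpace ℝ ι}
    (hF : DifferentiableAt ℝ F x) (α : κ) (i : ι) :
    jacobian (fun α x => F x α) x α i = fderiv ℝ F x (EuclideanSpace.single i 1) α := by
  have h := ((EuclideanSpace.proj α : EuclideanSpace ℝ κ →L[ℝ] ℝ).hasFDerivAt (x := F x)).comp x
    hF.hasFDerivAt
  have h' : fderiv ℝ (fun x => F x α) x = _ := h.fderiv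
  rw [jacobian, Matrix.of_apply, grad, h']
  rfl

lemma rank_jacobian {F : EuclideanSpace ℝ ι → EuclideanSpace ℝ κ} {x : EuclideanSpace ℝ ι}
    (hF : DifferentiableAt ℝ F x) :
    (jacobian (fun α x => F x α) x).rank =
      Module.finrank ℝ (LinearMap.range
        (fderiv ℝ F x : EuclideanSpace ℝ ι →ₗ[ℝ] EuclideanSpace ℝ κ)) := by
  classical
  have h : jacobian (fun α x => F x α) x = LinearMap.toMatrix
      (EuclideanSpace.basisFun ι ℝ).toBasis (EuclideanSpace.basisFun κ ℝ).toBasis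
      (fderiv ℝ F x : EuclideanSpace ℝ ι →ₗ[ℝ] EuclideanSpace ℝ κ) := by
    ext α i
    rw [jacobian_apply hF, LinearMap.toMatrix_apply]
    simp
  rw [h, rank_eq_finrank_range_toLin _ (EuclideanSpace.basisFun κ ℝ).toBasis
    (EuclideanSpace.basisFun ι ℝ).toBasis, Matrix.toLin_toMatrix]

omit [DecidableEq ι] in
/-- A `C²` map near a closed set agrees near that set with a globally defined `C²` map. -/
lemma exists_contDiff_eventuallyEq {η : EuclideanSpace ℝ ι → EuclideanSpace ℝ κ}
    {S V : Set (EuclideanSpace ℝ ι)} (hS : IsClosed S) (hV : IsOpen V) (hSV : S ⊆ V)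
    (hη : ContDiffOn ℝ 2 η V) :
    ∃ ζ : EuclideanSpace ℝ ι → EuclideanSpace ℝ κ, ContDiff ℝ 2 ζ ∧ ∀ y ∈ S, ζ =ᶠ[𝓝 y] η := by
  obtain ⟨β, h0, h1, -⟩ := exists_contMDiffMap_zero_one_nhds_of_isClosed (n := 2)
    (modelWithCornersSelf ℝ (EuclideanSpace ℝ ι)) hV.isClosed_compl hS
    (disjoint_compl_left_iff_subset.mpr hSV)
  have hβ : ContDiff ℝ 2 β := β.contMDiff.contDiff
  refine ⟨fun x => β x • η x, contDiff_iff_contDiffAt.mpr fun x => ?_, fun y hy => ?_⟩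
  · by_cases hx : x ∈ V
    · exact hβ.contDiffAt.smul (hη.contDiffAt (hV.mem_nhds hx))
    · refine (contDiffAt_const (c := 0)).congr_of_eventuallyEq ?_
      filter_upwards [eventually_nhdsSet_iff_forall.mp h0 x hx] with z hz
      rw [hz, zero_smul]
  · filter_upwards [eventually_nhdsSet_iff_forall.mp h1 y hy] with z hz
    rw [hz, one_smul]

omit [DecidableEq ι] in
/-- A function which is Lipschitz on the ball and vanishes continuously on the sphere is a test
function. -/
lemma LipOnBall.isTest [Nonempty ι] {u : EuclideanSpace ℝ ι → ℝ} (hu : LipOnBall u)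
    (hc : ContinuousOn u (closedBall 0 1)) (h0 : ∀ y ∈ sphere 0 1, u y = 0) : IsTest u := by
  classical
  refine ⟨hu, ?_⟩
  obtain ⟨K, hK⟩ := hu
  have hcl : closure (ball (0 : EuclideanSpace ℝ ι) 1) = closedBall 0 1 :=
    closure_ball _ one_ne_zero
  rw [← lipschitzOnWith_closure_iff (hcl ▸ hc), hcl] at hK
  refine ⟨K, fun x hx => ?_⟩
  obtain ⟨y, hy, hxy⟩ := exists_mem_sphere_dist_le_one_sub_norm hx
  have h := hK.dist_le_mul x (ball_subset_closedBall hx) y (sphere_subset_closedBall hy)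
  rw [h0 y hy, dist_zero_right, Real.norm_eq_abs] at h
  exact h.trans (mul_le_mul_of_nonneg_left hxy K.coe_nonneg)

end Euclidean

section MinimalSurfaceSystem

variable {n m : ℕ} {F : EuclideanSpace ℝ (Fin (n + 1)) → EuclideanSpace ℝ (Fin (m + 1))}

lemma mssMetric_eq {x : EuclideanSpace ℝ (Fin (n + 1))} (hF : DifferentiableAt ℝ F x) :
    mssMetric F x = 1 + (jacobian (fun α x => F x α) x)ᵀ * jacobian (fun α x => F x α) x := by
  ext i j
  simp only [mssMetric, Matrix.add_apply, Matrix.mul_apply, Matrix.transpose_apply,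
    jacobian_apply hF, Matrix.one_apply]

namespace IsMSSolution

variable {f : EuclideanSpace ℝ (Fin (n + 1)) → EuclideanSpace ℝ (Fin (m + 1))}

lemma lipOnBall (hF : IsMSSolution n m (ball 0 1) f F) (α : Fin (m + 1)) :
    LipOnBall fun x => F x α := by
  obtain ⟨K, hK⟩ := hF.2.1
  refine ⟨K, LipschitzOnWith.of_dist_le_mul fun x hx y hy => ?_⟩
  refine le_trans ?_ (hK.dist_le_mul x hx y hy)
  rw [Real.dist_eq, dist_eq_norm, ← Real.norm_eq_abs]
  exact PiLp.norm_apply_le (F x - F y) α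

lemma ae_differentiableAt (hF : IsMSSolution n m (ball 0 1) f F) :
    ∀ᵐ x ∂volume.restrict (ball 0 1), DifferentiableAt ℝ F x := by
  filter_upwards [ae_all_iff.mpr fun α => (hF.lipOnBall α).ae_differentiableAt] with x hx
  exact differentiableAt_euclidean.mpr hx

lemma isWeakSolution (hF : IsMSSolution n m (ball 0 1) f F) :
    IsWeakSolution fun α x => F x α := by
  have hA := IsWeakSolution.bddMeas_areaCoeff hF.lipOnBall
  refine ⟨hF.lipOnBall, fun j φ => integral_eq_zero_of_isTest (fun i => hA i j)
    fun φ h1 h2 h3 => ?_, fun α φ => integral_eq_zero_of_isTest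
      (fun i => .dotProduct (hA i) (hF.lipOnBall α).grad_bddMeas) fun φ h1 h2 h3 => ?_⟩
  · rw [← (hF.2.2.2 φ h1 h2 h3).1 j]
    refine integral_congr_ae ?_
    filter_upwards [hF.ae_differentiableAt] with x hx
    rw [mssMetric_eq hx]
    exact Finset.sum_congr rfl fun i _ => mul_comm _ _
  · rw [← (hF.2.2.2 φ h1 h2 h3).2 α]
    refine integral_congr_ae ?_
    filter_upwards [hF.ae_differentiableAt] with x hx
    rw [mssMetric_eq hx]
    refine Finset.sum_congr rfl fun i _ => ?_
    simp only [dotProduct, Finset.mul_sum]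
    refine Finset.sum_congr rfl fun j _ => ?_
    rw [← jacobian_apply hx, mul_comm]
    rfl

/-- The mass bound for solutions whose boundary data extend to a `C²` map `R • ζ`. -/
lemma mass_le {ζ : EuclideanSpace ℝ (Fin (n + 1)) → EuclideanSpace ℝ (Fin (m + 1))}
    {R c₀ c₁ : ℝ} {l : ℕ} (hF : IsMSSolution n m (ball 0 1) f F) (hR : 1 ≤ R)
    (hζ : ContDiff ℝ 2 ζ) (hf : ∀ y ∈ sphere 0 1, f y = R • ζ y)
    (hrank : ∀ y ∈ sphere (0 : EuclideanSpace ℝ (Fin (n + 1))) 1,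
      (jacobian (fun α x => ζ x α) y).rank ≤ l)
    (hc₀ : ∀ x ∈ ball 0 1, ∑ α, |ζ x α| ≤ c₀)
    (hc₁ : ∀ y ∈ sphere (0 : EuclideanSpace ℝ (Fin (n + 1))) 1,
      ∑ α, jacobian (fun α x => ζ x α) y α ⬝ᵥ jacobian (fun α x => ζ x α) y α ≤ c₁) :
    (n + 1) * ∫ x in ball 0 1, √(mssMetric F x).det ≤
      (1 + R * c₀) * (R ^ l * √((1 + 2 * c₁) ^ l)) *
        ((n + 2) * volume.real (ball (0 : EuclideanSpace ℝ (Fin (n + 1))) 1)) := by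
  have hζα : ∀ α, ContDiff ℝ 2 fun x => ζ x α := contDiff_euclidean.mp hζ
  have hcl : closure (ball (0 : EuclideanSpace ℝ (Fin (n + 1))) 1) = closedBall 0 1 :=
    closure_ball _ one_ne_zero
  have htest : ∀ α, IsTest fun x => F x α - R * ζ x α := fun α => by
    refine LipOnBall.isTest ((hF.lipOnBall α).sub ((LipOnBall.const R).mul
      (.of_contDiff ((hζα α).of_le one_le_two)))) ?_ fun y hy => ?_
    · exact ((EuclideanSpace.proj α :
        EuclideanSpace ℝ (Fin (m + 1)) →L[ℝ] ℝ).continuous.comp_continuousOn (hcl ▸ hF.1)).sub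
          (continuous_const.mul (hζα α).continuous).continuousOn
    · have h := hF.2.2.1 y (by rwa [frontier_ball _ one_ne_zero])
      rw [h, hf y hy]
      simp
  have h := hF.isWeakSolution.mass_le hR hζα htest hrank hc₀ hc₁
  have e : ∫ x in ball 0 1, √(mssMetric F x).det = ∫ x in ball 0 1,
      √(1 + (jacobian (fun α x => F x α) x)ᵀ * jacobian (fun α x => F x α) x).det := by
    refine integral_congr_ae ?_
    filter_upwards [hF.ae_differentiableAt] with x hx
    rw [mssMetric_eq hx]
  rw [Fintype.card_fin] at h
  push_cast at h
  rw [e]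
  convert h using 3
  ring

end IsMSSolution

end MinimalSurfaceSystem

end Analysis

/-- Upper mass bound: if `η` is C² near the sphere with differential of rank at most `l < n`,
then there is `C > 0` such that any solution of the Dirichlet problem with boundary data
`R·η`, `R ≥ 1`, has mass at most `C·R^{l+1}`. -/
theorem mass_upper_bound (n m l : ℕ) (hn : 0 < n) (hm : 0 < m) (hl : 0 < l) (hln : l < n)
    (η : EuclideanSpace ℝ (Fin (n+1)) → EuclideanSpace ℝ (Fin (m+1)))
    (V : Set (EuclideanSpace ℝ (Fin (n+1)))) (hVopen : IsOpen V)
    (hSV : Metric.sphere (0 : EuclideanSpace ℝ (Fin (n+1))) 1 ⊆ V)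
    (hηC2 : ContDiffOn ℝ 2 η V)
    (hrank : ∀ x ∈ Metric.sphere (0 : EuclideanSpace ℝ (Fin (n+1))) 1,
      Module.finrank ℝ
        (LinearMap.range ((fderiv ℝ η x : EuclideanSpace ℝ (Fin (n+1)) →L[ℝ]
          EuclideanSpace ℝ (Fin (m+1))) :
            EuclideanSpace ℝ (Fin (n+1)) →ₗ[ℝ] EuclideanSpace ℝ (Fin (m+1)))) ≤ l) :
    ∃ C > (0:ℝ), ∀ R : ℝ, 1 ≤ R →
      ∀ F : EuclideanSpace ℝ (Fin (n+1)) → EuclideanSpace ℝ (Fin (m+1)),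
        IsMSSolution n m (Metric.ball (0 : EuclideanSpace ℝ (Fin (n+1))) 1)
          (fun x => R • η x) F →
        (∫ x in Metric.ball (0 : EuclideanSpace ℝ (Fin (n+1))) 1,
          Real.sqrt (mssMetric F x).det) ≤ C * R ^ (l+1) := by
  classical
  obtain ⟨ζ, hζ, hζη⟩ := exists_contDiff_eventuallyEq Metric.isClosed_sphere hVopen hSV hηC2
  have hζα : ∀ α, ContDiff ℝ 2 fun x => ζ x α := contDiff_euclidean.mp hζ
  have hrank' : ∀ y ∈ Metric.sphere (0 : EuclideanSpace ℝ (Fin (n + 1))) 1,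
      (jacobian (fun α x => ζ x α) y).rank ≤ l := fun y hy => by
    rw [rank_jacobian (hζ.contDiffAt.differentiableAt two_ne_zero), (hζη y hy).fderiv_eq]
    exact hrank y hy
  obtain ⟨c₀, hc₀⟩ := (isCompact_closedBall (0 : EuclideanSpace ℝ (Fin (n + 1))) 1).bddAbove_image
    (f := fun x => ∑ α, |ζ x α|)
    (continuous_finsetSum _ fun α _ => (hζα α).continuous.abs).continuousOn
  have hgrad : ∀ α i, Continuous fun x => jacobian (fun α x => ζ x α) x α i := fun α i =>
    ((hζα α).continuous_fderiv two_ne_zero).clm_apply continuous_const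
  obtain ⟨c₁, hc₁⟩ := (isCompact_sphere (0 : EuclideanSpace ℝ (Fin (n + 1))) 1).bddAbove_image
    (f := fun y => ∑ α, jacobian (fun α x => ζ x α) y α ⬝ᵥ jacobian (fun α x => ζ x α) y α)
    (continuous_finsetSum _ fun α _ => continuous_finsetSum _ fun i _ =>
      (hgrad α i).mul (hgrad α i)).continuousOn
  have hc₀' : ∀ x ∈ Metric.ball 0 1, ∑ α, |ζ x α| ≤ c₀ := fun x hx =>
    hc₀ (Set.mem_image_of_mem _ (Metric.ball_subset_closedBall hx))
  have h0 : 0 ≤ c₀ := (Finset.sum_nonneg fun α _ => abs_nonneg _).trans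
    (hc₀' 0 (Metric.mem_ball_self one_pos))
  set D : ℝ := √((1 + 2 * c₁) ^ l) *
    ((n + 2) * volume.real (Metric.ball (0 : EuclideanSpace ℝ (Fin (n + 1))) 1)) with hD
  have hD0 : 0 ≤ D := by positivity
  refine ⟨(1 + c₀) * D + 1, by positivity, fun R hR F hF => ?_⟩
  have h := hF.mass_le hR hζ (fun y hy => by rw [(hζη y hy).eq_of_nhds]) hrank' hc₀'
    fun y hy => hc₁ (Set.mem_image_of_mem _ hy)
  have hM : 0 ≤ ∫ x in Metric.ball 0 1, √(mssMetric F x).det :=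
    integral_nonneg fun x => Real.sqrt_nonneg _
  calc ∫ x in Metric.ball 0 1, √(mssMetric F x).det
      ≤ (n + 1) * ∫ x in Metric.ball 0 1, √(mssMetric F x).det :=
        le_mul_of_one_le_left hM (by linarith [n.cast_nonneg (α := ℝ)])
    _ ≤ (1 + R * c₀) * R ^ l * D := h.trans_eq (by rw [hD]; ring)
    _ ≤ (R * (1 + c₀)) * R ^ l * D := by gcongr; linarith
    _ = (1 + c₀) * D * R ^ (l + 1) := by ring
    _ ≤ ((1 + c₀) * D + 1) * R ^ (l + 1) := by gcongr; linarith
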